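/- arXiv:1707.02656 — 2 statements merged into one kernel-verified Lean document; each statement's English description precedes it below -/
import Mathlib

section
/- Let G = (V,E) be a multigraph with vertex set [r] = {1,…,r}, rooted at v = 1. Then, as polynomials in q, Σ_{S ⊆ E with (V,S) connected} (q−1)^{#S} = (q−1)^{r−1} · q^{ℓ(G)} · Σ_T Π_{w ∈ [r]∖{1}} [δ_T(w)]_q, where the sum runs over all spanning trees T of G̃ having no κ-inversion and ℓ(G) is the number of loops of G. (This combines Lemma 3.3 with Proposition 3.1, i.e. it is the tree-product formula for the Tutte specialization T_G(1,q) that the recursion argument of Proposition 3.1 establishes.) -/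
open Finset

open scoped Classical

noncomputable section

/-! ### Set partitions -/

/-- `π` is a set partition of the finite set `H`. -/
def IsSetPartition {α : Type*} (π : Finset (Finset α)) (H : Finset α) : Prop :=
  (∀ B ∈ π, B ⊆ H) ∧ (∀ B ∈ π, B.Nonempty) ∧
    (∀ B ∈ π, ∀ C ∈ π, B ≠ C → Disjoint B C) ∧ (∀ a ∈ H, ∃ B ∈ π, a ∈ B)

/-- The finite set of all set partitions of `H`. -/
def setPartitions {α : Type*} (H : Finset α) : Finset (Finset (Finset α)) :=
  H.powerset.powerset.filter (fun π => IsSetPartition π H)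

/-- The joint cumulant of the family `u` on the subset `H`. -/
def jointCumulant {A : Type*} [CommRing A] {ι : Type*} (u : Finset ι → A) (H : Finset ι) : A :=
  ∑ π ∈ setPartitions H,
    (-1 : A) ^ (π.card - 1) * ((π.card - 1).factorial : A) * ∏ B ∈ π, u B

/-! ### Multigraphs -/

/-- Number of edges of the multigraph with endpoint map `ends` whose endpoint set is `{i,j}`. -/
def eCnt {V E : Type*} [Fintype E] (ends : E → Sym2 V) (i j : V) : ℕ :=
  (univ.filter fun e => ends e = s(i, j)).card

/-- The spanning subgraph `(V, S)` is connected. -/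
def SConnected {V E : Type*} (ends : E → Sym2 V) (S : Finset E) : Prop :=
  ∀ v w : V, Relation.ReflTransGen (fun a b => ∃ e ∈ S, ends e = s(a, b)) v w

/-- The subgraph `(B, S)` is connected. -/
def SConnectedOn {V E : Type*} (ends : E → Sym2 V) (B : Finset V) (S : Finset E) : Prop :=
  ∀ v ∈ B, ∀ w ∈ B, Relation.ReflTransGen (fun a b => ∃ e ∈ S, ends e = s(a, b)) v w

/-- `E|_B`: the edges with both endpoints in `B`. -/
def edgesIn {V E : Type*} [Fintype E] (ends : E → Sym2 V) (B : Finset V) : Finset E :=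
  univ.filter fun e => ∀ v ∈ ends e, v ∈ B

/-- `c_{G|_B}(q) = Σ_{S ⊆ E|_B, (B,S) connected} q^{#S}` as a polynomial in `q`. -/
def connPoly {V E : Type*} [Fintype E] (ends : E → Sym2 V) (B : Finset V) : Polynomial ℤ :=
  ∑ S ∈ (edgesIn ends B).powerset.filter (fun S => SConnectedOn ends B S),
    Polynomial.X ^ S.card

/-- Number of edges joining `w` to some vertex of `B`. -/
def dCnt {V E : Type*} [Fintype E] (ends : E → Sym2 V) (B : Finset V) (w : V) : ℕ :=
  (univ.filter fun e => ∃ b ∈ B, ends e = s(w, b)).card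

/-! ### The `G`-inversion polynomial -/

/-- `[m]_q = 1 + q + ⋯ + q^{m-1}`. -/
def nq {R : Type*} [CommSemiring R] (q : R) (m : ℕ) : R := ∑ k ∈ Finset.range m, q ^ k

/-- Rooted spanning trees (encoded by parent maps, rooted at `0`) of the simple graph `G̃`
underlying the multigraph on `Fin (r+1)` with edge multiplicities `e`. -/
def parentMaps {r : ℕ} (e : Fin (r+1) → Fin (r+1) → ℕ) : Finset (Fin (r+1) → Fin (r+1)) :=
  univ.filter fun p => p 0 = 0 ∧ (∀ w, w ≠ 0 → p w ≠ w ∧ 0 < e w (p w)) ∧ ∀ w, ∃ k, p^[k] w = 0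

/-- `(i,j)` is a `κ`-inversion of the spanning tree encoded by `p`. -/
def isKappaInv {r : ℕ} (e : Fin (r+1) → Fin (r+1) → ℕ) (p : Fin (r+1) → Fin (r+1))
    (i j : Fin (r+1)) : Prop :=
  i ≠ 0 ∧ j ≠ 0 ∧ i ≠ j ∧ (∃ k, p^[k] j = i) ∧ j < i ∧ p i ≠ j ∧ 0 < e j (p i)

/-- `κ(T) = Σ_{(i,j) κ-inversion} e_{parent(i), j}`. -/
def kappaStat {r : ℕ} (e : Fin (r+1) → Fin (r+1) → ℕ) (p : Fin (r+1) → Fin (r+1)) : ℕ :=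
  ∑ pr ∈ (univ ×ˢ univ : Finset (Fin (r+1) × Fin (r+1))).filter
    (fun pr => isKappaInv e p pr.1 pr.2), e (p pr.1) pr.2

/-- `δ_T(w) = Σ_u e_{u, parent(w)}`, `u` ranging over descendants of `w` together with `w`. -/
def deltaStat {r : ℕ} (e : Fin (r+1) → Fin (r+1) → ℕ) (p : Fin (r+1) → Fin (r+1))
    (w : Fin (r+1)) : ℕ :=
  ∑ u ∈ univ.filter (fun u => ∃ k, p^[k] u = w), e u (p w)

/-- The `G`-inversion polynomial `𝓘_G(q)` of the multigraph on `Fin (r+1)` with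
edge multiplicities `e`, evaluated at an element `q` of a commutative (semi)ring. -/
def Iinv {r : ℕ} {R : Type*} [CommSemiring R] (e : Fin (r+1) → Fin (r+1) → ℕ) (q : R) : R :=
  q ^ (∑ i, e i i) *
    ∑ p ∈ parentMaps e, q ^ kappaStat e p * ∏ w ∈ univ.erase (0 : Fin (r+1)), nq q (e w (p w))

/-! ### Partitions, Young diagrams and fillings -/

/-- `f : ℕ → ℕ` encodes a partition: `f j` is the `j`-th part (for `j ≥ 1`). -/
def IsPartitionFun (f : ℕ → ℕ) : Prop := Antitone f ∧ ∃ N, f N = 0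

/-- The number of (nonempty) rows of the diagram of `f`. -/
def nRows (f : ℕ → ℕ) : ℕ := sSup {j | f j ≠ 0}

/-- `λ^t_i`: the length of the `i`-th column of the diagram of `f`. -/
def colLen (f : ℕ → ℕ) (i : ℕ) : ℕ :=
  ((Finset.Icc 1 (nRows f)).filter (fun j => i ≤ f j)).card

/-- The cells `(i,j)`, `1 ≤ i ≤ f j`, `j ≥ 1`, of the Young diagram of `f`
(French convention, `i` the column index and `j` the row index). -/
def cells (f : ℕ → ℕ) : Finset (ℕ × ℕ) :=
  (Finset.Icc 1 (f 1) ×ˢ Finset.Icc 1 (nRows f)).filter (fun c => c.1 ≤ f c.2)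

/-- Fillings of the diagram of `f` with entries in `{1, …, N}`, encoded as functions
`ℕ × ℕ → ℕ` vanishing outside the diagram. -/
def fillings (f : ℕ → ℕ) (N : ℕ) : Finset ((ℕ × ℕ) → ℕ) :=
  ((cells f).pi (fun _ => Finset.Icc 1 N)).image
    (fun g c => if h : c ∈ cells f then g c h else 0)

/-- The descent set of a filling. -/
def desSet (f : ℕ → ℕ) (σ : (ℕ × ℕ) → ℕ) : Finset (ℕ × ℕ) :=
  (cells f).filter (fun c => 2 ≤ c.2 ∧ σ (c.1, c.2 - 1) < σ c)

/-- `maj(σ) = Σ_{□ ∈ Des(σ)} (leg(□) + 1)`. -/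
def majStat (f : ℕ → ℕ) (σ : (ℕ × ℕ) → ℕ) : ℕ :=
  ∑ c ∈ desSet f σ, (colLen f c.1 - c.2 + 1)

/-- The counterclockwise-increasing condition defining inversion pairs; the box below `c1`
is read via `σ`, which vanishes off the diagram (giving the convention `σ(□_3) = 0`). -/
def invTriple (σ : (ℕ × ℕ) → ℕ) (c1 c2 : ℕ × ℕ) : Prop :=
  (σ c1 ≤ σ (c1.1, c1.2 - 1) ∧ σ (c1.1, c1.2 - 1) < σ c2) ∨
  (σ (c1.1, c1.2 - 1) < σ c2 ∧ σ c2 < σ c1) ∨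
  (σ c2 < σ c1 ∧ σ c1 ≤ σ (c1.1, c1.2 - 1))

/-- The set of inversion pairs of a filling. -/
def invPairs (f : ℕ → ℕ) (σ : (ℕ × ℕ) → ℕ) : Finset ((ℕ × ℕ) × (ℕ × ℕ)) :=
  ((cells f) ×ˢ (cells f)).filter
    (fun pr => pr.1.2 = pr.2.2 ∧ pr.1.1 < pr.2.1 ∧ invTriple σ pr.1 pr.2)

/-- `inv(σ)`: the number of inversion pairs. -/
def invStat (f : ℕ → ℕ) (σ : (ℕ × ℕ) → ℕ) : ℕ := (invPairs f σ).card

/-! ### The ring `ℤ[q, t, x₁, x₂, …]` and Macdonald polynomials -/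

/-- The polynomial ring `ℤ[q, t, x₀, x₁, x₂, …]`. -/
abbrev MR : Type := MvPolynomial (Fin 2 ⊕ ℕ) ℤ

/-- The variable `q`. -/
def qv : MR := MvPolynomial.X (Sum.inl 0)

/-- The variable `t`. -/
def tv : MR := MvPolynomial.X (Sum.inl 1)

/-- The variable `x_k`. -/
def xv (k : ℕ) : MR := MvPolynomial.X (Sum.inr k)

/-- Haglund's formula: the modified Macdonald polynomial in the variables `x_1, …, x_N`. -/
def macH (f : ℕ → ℕ) (N : ℕ) : MR :=
  ∑ σ ∈ fillings f N, qv ^ invStat f σ * tv ^ majStat f σ * ∏ c ∈ cells f, xv (σ c)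

/-- `λ^B = ⊕_{b ∈ B} λ^b`. -/
def lamB {r : ℕ} (lam : Fin (r+1) → ℕ → ℕ) (B : Finset (Fin (r+1))) : ℕ → ℕ :=
  fun j => ∑ b ∈ B, lam b j

/-- The (unnormalized) Macdonald cumulant
`Σ_{π ∈ 𝒫([r])} (-1)^{#π-1} (#π-1)! Π_{B ∈ π} H̃_{λ^B}`. -/
def macCumulant {r : ℕ} (lam : Fin (r+1) → ℕ → ℕ) (N : ℕ) : MR :=
  ∑ π ∈ setPartitions (univ : Finset (Fin (r+1))),
    (-1 : MR) ^ (π.card - 1) * ((π.card - 1).factorial : MR) * ∏ B ∈ π, macH (lamB lam B) N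

/-! ### Coloring of the diagram `λ^B` -/

/-- Labels `(b, i)`, `b ∈ B`, `1 ≤ i ≤ λ^b_1`, of the columns of the diagrams `λ^b`, `b ∈ B`. -/
def columnPairs {r : ℕ} (lam : Fin (r+1) → ℕ → ℕ) (B : Finset (Fin (r+1))) :
    Finset (Fin (r+1) × ℕ) :=
  (B ×ˢ Finset.Icc 1 (lamB lam B 1)).filter (fun p => p.2 ≤ lam p.1 1)

/-- The column `p'` comes weakly before the column `p` in the sorted order
(longer first; ties first by color, then by column index). -/
def colBefore {r : ℕ} (lam : Fin (r+1) → ℕ → ℕ) (p' p : Fin (r+1) × ℕ) : Prop :=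
  colLen (lam p.1) p.2 < colLen (lam p'.1) p'.2 ∨
    (colLen (lam p'.1) p'.2 = colLen (lam p.1) p.2 ∧
      (p'.1 < p.1 ∨ (p'.1 = p.1 ∧ p'.2 ≤ p.2)))

/-- The position in `λ^B` of the column `i` of `λ^b`. -/
def posIn {r : ℕ} (lam : Fin (r+1) → ℕ → ℕ) (B : Finset (Fin (r+1)))
    (b : Fin (r+1)) (i : ℕ) : ℕ :=
  ((columnPairs lam B).filter (fun p' => colBefore lam p' (b, i))).card

/-- The label `(b, i)` of the column of `λ^B` at position `c`. -/
def colAt {r : ℕ} (lam : Fin (r+1) → ℕ → ℕ) (B : Finset (Fin (r+1))) (c : ℕ) :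
    Fin (r+1) × ℕ :=
  if h : ∃ p ∈ columnPairs lam B, posIn lam B p.1 p.2 = c then h.choose else (0, 1)

/-- The filling `σ^B` of `λ^B` induced from a filling `σ` of `λ^{[r]}` via the
identification of boxes given by the coloring. -/
def inducedFilling {r : ℕ} (lam : Fin (r+1) → ℕ → ℕ) (B : Finset (Fin (r+1)))
    (σ : (ℕ × ℕ) → ℕ) : (ℕ × ℕ) → ℕ :=
  fun cj =>
    if ∃ p ∈ columnPairs lam B, posIn lam B p.1 p.2 = cj.1 then
      σ (posIn lam univ (colAt lam B cj.1).1 (colAt lam B cj.1).2, cj.2)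
    else 0

/-- The color of the column `x` of `λ^{[r]}`. -/
def colColor {r : ℕ} (lam : Fin (r+1) → ℕ → ℕ) (x : ℕ) : Fin (r+1) :=
  (colAt lam univ x).1

/-- Edge multiplicities of the multigraph `G^σ`: the number of inversion pairs of `σ`
colored by `{i, j}`. -/
def eG {r : ℕ} (lam : Fin (r+1) → ℕ → ℕ) (σ : (ℕ × ℕ) → ℕ) (i j : Fin (r+1)) : ℕ :=
  ((invPairs (lamB lam univ) σ).filter (fun pr =>
    (colColor lam pr.1.1 = i ∧ colColor lam pr.2.1 = j) ∨
    (colColor lam pr.1.1 = j ∧ colColor lam pr.2.1 = i))).card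

/-- Edge multiplicities of the multigraph `G^{□_1,…,□_s}` attached to a set `D` of boxes:
for each box of `D` and each box strictly to its left in the same row, one edge joining
the colors of the two columns. -/
def eBox {r : ℕ} (lam : Fin (r+1) → ℕ → ℕ) (D : Finset (ℕ × ℕ)) (i j : Fin (r+1)) : ℕ :=
  ((D ×ˢ cells (lamB lam univ)).filter (fun pr =>
    pr.2.2 = pr.1.2 ∧ pr.2.1 < pr.1.1 ∧
      ((colColor lam pr.2.1 = i ∧ colColor lam pr.1.1 = j) ∨
       (colColor lam pr.2.1 = j ∧ colColor lam pr.1.1 = i)))).card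

/-! ### Rooted trees encoded by parent maps -/

section RootedTrees

variable {V : Type*}

lemma exists_iterate_eq_iff (p : V → V) (u w : V) :
    (∃ k, p^[k] u = w) ↔ u = w ∨ ∃ k, p^[k] (p u) = w := by
  constructor
  · rintro ⟨k, hk⟩
    cases k with
    | zero => exact Or.inl hk
    | succ k => exact Or.inr ⟨k, hk⟩
  · rintro (h | ⟨k, hk⟩)
    · exact ⟨0, h⟩
    · exact ⟨k + 1, hk⟩

lemma exists_iterate_eq_iff_of_fixed {p : V → V} {u : V} (h : p u = u) (w : V) :
    (∃ k, p^[k] u = w) ↔ u = w := by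
  constructor
  · rintro ⟨k, hk⟩
    rwa [Function.iterate_fixed h] at hk
  · exact fun hu => ⟨0, hu⟩

section Graft

variable [DecidableEq V]

/-- Attach a tree on `C` with root `c` to the vertex `v` of another tree. -/
def graft (C : Finset V) (c v : V) (p₁ p₂ : V → V) : V → V :=
  fun u => if u = c then v else if u ∈ C then p₁ u else p₂ u

variable {C : Finset V} {c v : V} {p₁ p₂ : V → V}

lemma graft_root : graft C c v p₁ p₂ c = v := by simp [graft]

lemma graft_of_mem {u : V} (hu : u ∈ C) (huc : u ≠ c) : graft C c v p₁ p₂ u = p₁ u := by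
  simp [graft, hu, huc]

lemma graft_of_notMem (hc : c ∈ C) {u : V} (hu : u ∉ C) : graft C c v p₁ p₂ u = p₂ u := by
  have : u ≠ c := fun h => hu (h ▸ hc)
  simp [graft, hu, this]

end Graft

variable [Fintype V]

/-- The descendants of `w`, together with `w` itself. -/
def descendants (p : V → V) (w : V) : Finset V := univ.filter fun u => ∃ k, p^[k] u = w

/-- Parent maps of the trees with vertex set `B` and root `v`; vertices outside `B` are fixed. -/
def rootedTrees (B : Finset V) (v : V) : Finset (V → V) :=
  univ.filter fun p => (∀ u, u ∉ B → p u = u) ∧ p v = v ∧ (∀ u ∈ B, p u ∈ B) ∧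
    ∀ u ∈ B, ∃ k, p^[k] u = v

lemma mem_descendants {p : V → V} {u w : V} : u ∈ descendants p w ↔ ∃ k, p^[k] u = w := by
  simp [descendants]

lemma mem_descendants_iff {p : V → V} {u w : V} :
    u ∈ descendants p w ↔ u = w ∨ p u ∈ descendants p w := by
  simp only [mem_descendants]
  exact exists_iterate_eq_iff p u w

lemma mem_descendants_iff_of_fixed {p : V → V} {u w : V} (h : p u = u) :
    u ∈ descendants p w ↔ u = w := by
  rw [mem_descendants]
  exact exists_iterate_eq_iff_of_fixed h w

lemma mem_rootedTrees {B : Finset V} {v : V} {p : V → V} :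
    p ∈ rootedTrees B v ↔ (∀ u, u ∉ B → p u = u) ∧ p v = v ∧ (∀ u ∈ B, p u ∈ B) ∧
      ∀ u ∈ B, u ∈ descendants p v := by
  simp [rootedTrees, mem_descendants]

/-- Induction along the path to the root. -/
lemma rootedTrees_induction {B : Finset V} {v : V} {p : V → V} (hp : p ∈ rootedTrees B v)
    {P : V → Prop} (root : P v) (step : ∀ u ∈ B, u ≠ v → P (p u) → P u) :
    ∀ u ∈ B, P u := by
  obtain ⟨-, -, hB, hr⟩ := mem_rootedTrees.1 hp
  have key : ∀ k, ∀ u ∈ B, p^[k] u = v → P u := by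
    intro k
    induction k with
    | zero =>
      intro u _ h
      have : u = v := h
      exact this ▸ root
    | succ k ih =>
      intro u hu h
      by_cases huv : u = v
      · exact huv ▸ root
      · exact step u hu huv (ih (p u) (hB u hu) h)
  intro u hu
  obtain ⟨k, hk⟩ := mem_descendants.1 (hr u hu)
  exact key k u hu hk

lemma descendants_subset {B : Finset V} {v w : V} {p : V → V} (hp : p ∈ rootedTrees B v)
    (hw : w ∈ B) : descendants p w ⊆ B := by
  intro u hu
  by_contra h
  have := (mem_descendants_iff_of_fixed ((mem_rootedTrees.1 hp).1 u h)).1 hu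
  exact h (this ▸ hw)

lemma root_notMem_descendants {B : Finset V} {v w : V} {p : V → V} (hp : p ∈ rootedTrees B v)
    (hw : w ≠ v) : v ∉ descendants p w := fun h =>
  hw ((mem_descendants_iff_of_fixed (mem_rootedTrees.1 hp).2.1).1 h).symm

lemma descendants_root {B : Finset V} {v : V} {p : V → V} (hv : v ∈ B)
    (hp : p ∈ rootedTrees B v) : descendants p v = B :=
  Subset.antisymm (descendants_subset hp hv) (mem_rootedTrees.1 hp).2.2.2

lemma parent_notMem_descendants {B : Finset V} {v : V} {p : V → V} (hp : p ∈ rootedTrees B v) :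
    ∀ u ∈ B, u ≠ v → p u ∉ descendants p u := by
  refine rootedTrees_induction hp (fun h => absurd rfl h) ?_
  intro u _ huv ih _ hu
  by_cases hpu : p u = v
  · exact root_notMem_descendants hp huv (hpu ▸ hu)
  · refine ih hpu (mem_descendants.2 ?_)
    obtain ⟨k, hk⟩ := mem_descendants.1 hu
    refine ⟨k, ?_⟩
    rw [← Function.iterate_succ_apply, Function.iterate_succ_apply', hk]

/-- Every non-root vertex lies below a child of the root. -/
lemma exists_branch {B : Finset V} {v : V} {p : V → V} (hp : p ∈ rootedTrees B v) :
    ∀ x ∈ B, x ≠ v → ∃ c ∈ B, c ≠ v ∧ p c = v ∧ x ∈ descendants p c := by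
  refine rootedTrees_induction hp (fun h => absurd rfl h) ?_
  intro u hu huv ih _
  by_cases h : p u = v
  · exact ⟨u, hu, huv, h, mem_descendants_iff.2 (Or.inl rfl)⟩
  · obtain ⟨c, hc, hcv, hpc, hd⟩ := ih h
    exact ⟨c, hc, hcv, hpc, mem_descendants_iff.2 (Or.inr hd)⟩

lemma branch_unique {B : Finset V} {v c c' : V} {p : V → V} (hp : p ∈ rootedTrees B v)
    (hc : c ≠ v) (hc' : c' ≠ v) (hpc : p c = v) (hpc' : p c' = v) :
    ∀ x ∈ B, x ∈ descendants p c → x ∈ descendants p c' → c = c' := by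
  have hv := root_notMem_descendants hp hc
  have hv' := root_notMem_descendants hp hc'
  refine rootedTrees_induction hp (fun h => absurd h hv) ?_
  intro u _ _ ih h h'
  rcases mem_descendants_iff.1 h with rfl | h
  · rcases mem_descendants_iff.1 h' with rfl | h'
    · rfl
    · rw [hpc] at h'
      exact absurd h' hv'
  · rcases mem_descendants_iff.1 h' with rfl | h'
    · rw [hpc'] at h
      exact absurd h hv
    · exact ih h h'

variable [DecidableEq V]

section Graft

variable {B C : Finset V} {c v : V} {p₁ p₂ : V → V}

lemma graft_mem_rootedTrees (hCB : C ⊆ B) (hvB : v ∈ B) (hvC : v ∉ C) (hc : c ∈ C)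
    (h₁ : p₁ ∈ rootedTrees C c) (h₂ : p₂ ∈ rootedTrees (B \ C) v) :
    graft C c v p₁ p₂ ∈ rootedTrees B v := by
  obtain ⟨-, -, hB₁, -⟩ := mem_rootedTrees.1 h₁
  obtain ⟨hf₂, hv₂, hB₂, -⟩ := mem_rootedTrees.1 h₂
  have hv : graft C c v p₁ p₂ v = v := by rw [graft_of_notMem hc hvC, hv₂]
  have hvd : v ∈ descendants (graft C c v p₁ p₂) v := mem_descendants_iff.2 (Or.inl rfl)
  have hr₁ : ∀ u ∈ C, u ∈ descendants (graft C c v p₁ p₂) v := by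
    refine rootedTrees_induction h₁ ?_ ?_
    · rw [mem_descendants_iff, graft_root]
      exact Or.inr hvd
    · intro u hu huc ih
      rw [mem_descendants_iff, graft_of_mem hu huc]
      exact Or.inr ih
  have hr₂ : ∀ u ∈ B \ C, u ∈ descendants (graft C c v p₁ p₂) v := by
    refine rootedTrees_induction h₂ hvd ?_
    intro u hu _ ih
    rw [mem_descendants_iff, graft_of_notMem hc (mem_sdiff.1 hu).2]
    exact Or.inr ih
  refine mem_rootedTrees.2 ⟨?_, hv, ?_, ?_⟩
  · intro u hu
    rw [graft_of_notMem hc fun h => hu (hCB h)]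
    exact hf₂ u fun h => hu (mem_sdiff.1 h).1
  · intro u hu
    by_cases huC : u ∈ C
    · by_cases huc : u = c
      · rwa [huc, graft_root]
      · rw [graft_of_mem huC huc]
        exact hCB (hB₁ u huC)
    · rw [graft_of_notMem hc huC]
      exact (mem_sdiff.1 (hB₂ u (mem_sdiff.2 ⟨hu, huC⟩))).1
  · intro u hu
    by_cases huC : u ∈ C
    · exact hr₁ u huC
    · exact hr₂ u (mem_sdiff.2 ⟨hu, huC⟩)

lemma descendants_graft_of_mem (hCB : C ⊆ B) (hvB : v ∈ B) (hvC : v ∉ C) (hc : c ∈ C)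
    (h₁ : p₁ ∈ rootedTrees C c) (h₂ : p₂ ∈ rootedTrees (B \ C) v)
    {w : V} (hw : w ∈ C) :
    descendants (graft C c v p₁ p₂) w = descendants p₁ w := by
  have hp := graft_mem_rootedTrees hCB hvB hvC hc h₁ h₂
  have hv := root_notMem_descendants hp fun h : w = v => hvC (h ▸ hw)
  have hin : ∀ u ∈ C, u ∈ descendants (graft C c v p₁ p₂) w ↔ u ∈ descendants p₁ w := by
    refine rootedTrees_induction h₁ ?_ ?_
    · rw [mem_descendants_iff, graft_root,
        mem_descendants_iff_of_fixed (mem_rootedTrees.1 h₁).2.1]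
      simp [hv]
    · intro u hu huc ih
      rw [mem_descendants_iff, graft_of_mem hu huc, ih, ← mem_descendants_iff]
  have hout : ∀ u ∈ B \ C, u ∉ descendants (graft C c v p₁ p₂) w := by
    refine rootedTrees_induction h₂ hv ?_
    intro u hu _ ih
    rw [mem_descendants_iff, graft_of_notMem hc (mem_sdiff.1 hu).2]
    rintro (rfl | h)
    · exact (mem_sdiff.1 hu).2 hw
    · exact ih h
  ext u
  constructor
  · intro hu
    have huC : u ∈ C := by
      by_contra huC
      exact hout u (mem_sdiff.2 ⟨descendants_subset hp (hCB hw) hu, huC⟩) hu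
    exact (hin u huC).1 hu
  · intro hu
    exact (hin u (descendants_subset h₁ hw hu)).2 hu

lemma descendants_graft_of_notMem (hCB : C ⊆ B) (hvB : v ∈ B) (hvC : v ∉ C) (hc : c ∈ C)
    (h₁ : p₁ ∈ rootedTrees C c) (h₂ : p₂ ∈ rootedTrees (B \ C) v)
    {w : V} (hw : w ∈ B \ C) (hwv : w ≠ v) :
    descendants (graft C c v p₁ p₂) w = descendants p₂ w := by
  have hp := graft_mem_rootedTrees hCB hvB hvC hc h₁ h₂
  have hv := root_notMem_descendants hp hwv
  have hwC := (mem_sdiff.1 hw).2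
  have hin : ∀ u ∈ C, u ∉ descendants (graft C c v p₁ p₂) w := by
    refine rootedTrees_induction h₁ ?_ ?_
    · rw [mem_descendants_iff, graft_root]
      rintro (h | h)
      · exact hwC (h ▸ hc)
      · exact hv h
    · intro u hu huc ih
      rw [mem_descendants_iff, graft_of_mem hu huc]
      rintro (h | h)
      · exact hwC (h ▸ hu)
      · exact ih h
  have hout : ∀ u ∈ B \ C,
      u ∈ descendants (graft C c v p₁ p₂) w ↔ u ∈ descendants p₂ w := by
    refine rootedTrees_induction h₂ ?_ ?_
    · simp [hv, root_notMem_descendants h₂ hwv]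
    · intro u hu _ ih
      rw [mem_descendants_iff, graft_of_notMem hc (mem_sdiff.1 hu).2, ih, ← mem_descendants_iff]
  ext u
  constructor
  · intro hu
    have huB := descendants_subset hp (mem_sdiff.1 hw).1 hu
    exact (hout u (mem_sdiff.2 ⟨huB, fun huC => hin u huC hu⟩)).1 hu
  · intro hu
    exact (hout u (descendants_subset h₂ hw hu)).2 hu

end Graft

/-- Cutting the edge between the root and one of its children. -/
lemma exists_eq_graft {B : Finset V} {c v : V} {p : V → V} (hp : p ∈ rootedTrees B v)
    (hc : c ∈ B) (hcv : c ≠ v) (hpc : p c = v) :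
    ∃ p₁ ∈ rootedTrees (descendants p c) c, ∃ p₂ ∈ rootedTrees (B \ descendants p c) v,
      graft (descendants p c) c v p₁ p₂ = p := by
  obtain ⟨hf, hv, hB, -⟩ := mem_rootedTrees.1 hp
  have hcc : c ∈ descendants p c := mem_descendants_iff.2 (Or.inl rfl)
  have hvC := root_notMem_descendants hp hcv
  have hCB := descendants_subset hp hc
  set C := descendants p c with hC
  set p₁ : V → V := fun u => if u ∈ C ∧ u ≠ c then p u else u with hp₁
  set p₂ : V → V := fun u => if u ∈ C then u else p u with hp₂
  refine ⟨p₁, mem_rootedTrees.2 ⟨?_, ?_, ?_, ?_⟩, p₂, mem_rootedTrees.2 ⟨?_, ?_, ?_, ?_⟩, ?_⟩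
  · intro u hu
    simp [hp₁, hu]
  · simp [hp₁]
  · intro u hu
    by_cases huc : u = c
    · simpa [hp₁, huc] using hcc
    · have : p u ∈ C := (mem_descendants_iff.1 hu).resolve_left huc
      simpa [hp₁, huc, hu] using this
  · have key : ∀ u ∈ B, u ∈ C → u ∈ descendants p₁ c := by
      refine rootedTrees_induction hp (fun h => absurd h hvC) ?_
      intro u _ _ ih hu
      by_cases huc : u = c
      · exact mem_descendants_iff.2 (Or.inl huc)
      · have h1 : p u ∈ C := (mem_descendants_iff.1 hu).resolve_left huc
        have h2 : p₁ u = p u := by simp [hp₁, hu, huc]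
        rw [mem_descendants_iff, h2]
        exact Or.inr (ih h1)
    exact fun u hu => key u (hCB hu) hu
  · intro u hu
    by_cases huC : u ∈ C
    · simp [hp₂, huC]
    · have : u ∉ B := fun h => hu (mem_sdiff.2 ⟨h, huC⟩)
      simp [hp₂, huC, hf u this]
  · simp [hp₂, hvC, hv]
  · intro u hu
    obtain ⟨huB, huC⟩ := mem_sdiff.1 hu
    have h1 : p₂ u = p u := by simp [hp₂, huC]
    rw [h1]
    exact mem_sdiff.2 ⟨hB u huB, fun h => huC (mem_descendants_iff.2 (Or.inr h))⟩
  · have key : ∀ u ∈ B, u ∉ C → u ∈ descendants p₂ v := by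
      refine rootedTrees_induction hp (fun _ => mem_descendants_iff.2 (Or.inl rfl)) ?_
      intro u _ _ ih hu
      have h1 : p₂ u = p u := by simp [hp₂, hu]
      rw [mem_descendants_iff, h1]
      exact Or.inr (ih fun h => hu (mem_descendants_iff.2 (Or.inr h)))
    exact fun u hu => key u (mem_sdiff.1 hu).1 (mem_sdiff.1 hu).2
  · funext u
    by_cases huc : u = c
    · rw [huc, graft_root, hpc]
    · by_cases huC : u ∈ C
      · rw [graft_of_mem huC huc]
        simp [hp₁, huC, huc]
      · rw [graft_of_notMem hcc huC]
        simp [hp₂, huC]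

/-- Sum over the trees on `B` rooted at `v` of a product of local weights. -/
def treeSum {R : Type*} [CommSemiring R] (g : Finset V → V → V → R) (B : Finset V) (v : V) : R :=
  ∑ p ∈ rootedTrees B v, ∏ w ∈ B.erase v, g (descendants p w) w (p w)

lemma treeSum_singleton {R : Type*} [CommSemiring R] (g : Finset V → V → V → R) (v : V) :
    treeSum g {v} v = 1 := by
  have : rootedTrees ({v} : Finset V) v = {id} := by
    ext p
    rw [mem_rootedTrees, mem_singleton]
    constructor
    · rintro ⟨h, hv, -⟩
      funext u
      by_cases huv : u = v
      · rw [huv, hv, id]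
      · exact h u (by simpa using huv)
    · rintro rfl
      refine ⟨fun _ _ => rfl, rfl, fun _ h => h, fun u h => ?_⟩
      exact mem_descendants_iff.2 (Or.inl (mem_singleton.1 h))
  simp [treeSum, this]

/-- Recursion obtained by cutting off the branch at the root that contains `x`. -/
lemma treeSum_eq {R : Type*} [CommSemiring R] (g : Finset V → V → V → R) {B : Finset V} {v x : V}
    (hv : v ∈ B) (hx : x ∈ B) (hxv : x ≠ v) :
    treeSum g B v = ∑ C ∈ (B.erase v).powerset.filter (fun C => x ∈ C), ∑ c ∈ C,
      g C c v * treeSum g C c * treeSum g (B \ C) v := by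
  have hrhs : ∀ C : Finset V, ∀ c : V, g C c v * treeSum g C c * treeSum g (B \ C) v =
      ∑ P ∈ rootedTrees C c ×ˢ rootedTrees (B \ C) v,
        g C c v * (∏ w ∈ C.erase c, g (descendants P.1 w) w (P.1 w)) *
          ∏ w ∈ (B \ C).erase v, g (descendants P.2 w) w (P.2 w) := by
    intro C c
    rw [treeSum, treeSum, mul_assoc, sum_mul_sum, ← sum_product', mul_sum]
    exact sum_congr rfl fun _ _ => (mul_assoc _ _ _).symm
  simp only [hrhs]
  simp only [sum_sigma']
  symm
  have hmem : ∀ a : (_ : Finset V) × (_ : V) × (V → V) × (V → V),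
      a ∈ ((B.erase v).powerset.filter (fun C => x ∈ C)).sigma
        (fun C => C.sigma fun c => rootedTrees C c ×ˢ rootedTrees (B \ C) v) ↔
      a.1 ⊆ B ∧ v ∉ a.1 ∧ x ∈ a.1 ∧ a.2.1 ∈ a.1 ∧ a.2.2.1 ∈ rootedTrees a.1 a.2.1 ∧
        a.2.2.2 ∈ rootedTrees (B \ a.1) v := by
    intro a
    simp only [mem_sigma, mem_filter, mem_powerset, mem_product, subset_erase]
    tauto
  refine sum_bij (fun a _ => graft a.1 a.2.1 v a.2.2.1 a.2.2.2) ?_ ?_ ?_ ?_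
  · intro a ha
    obtain ⟨h1, h2, -, h4, h5, h6⟩ := (hmem a).1 ha
    exact graft_mem_rootedTrees h1 hv h2 h4 h5 h6
  · rintro ⟨C, c, p₁, p₂⟩ ha ⟨C', c', p₁', p₂'⟩ ha' heq
    obtain ⟨h1, h2, h3, h4, h5, h6⟩ := (hmem _).1 ha
    obtain ⟨h1', h2', h3', h4', h5', h6'⟩ := (hmem _).1 ha'
    dsimp only at h1 h2 h3 h4 h5 h6 h1' h2' h3' h4' h5' h6' heq
    have hd : descendants (graft C c v p₁ p₂) c = C := by
      rw [descendants_graft_of_mem h1 hv h2 h4 h5 h6 h4, descendants_root h4 h5]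
    have hd' : descendants (graft C c v p₁ p₂) c' = C' := by
      rw [heq, descendants_graft_of_mem h1' hv h2' h4' h5' h6' h4', descendants_root h4' h5']
    have hcc : c = c' := by
      refine branch_unique (graft_mem_rootedTrees h1 hv h2 h4 h5 h6) (fun h => h2 (h ▸ h4))
        (fun h => h2' (h ▸ h4')) graft_root ?_ x hx (hd.symm ▸ h3) (hd'.symm ▸ h3')
      rw [heq, graft_root]
    subst hcc
    obtain rfl : C = C' := hd.symm.trans hd'
    have e1 : p₁ = p₁' := by
      funext u
      by_cases huc : u = c
      · rw [huc, (mem_rootedTrees.1 h5).2.1, (mem_rootedTrees.1 h5').2.1]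
      · by_cases hu : u ∈ C
        · have := congrFun heq u
          rwa [graft_of_mem hu huc, graft_of_mem hu huc] at this
        · rw [(mem_rootedTrees.1 h5).1 u hu, (mem_rootedTrees.1 h5').1 u hu]
    have e2 : p₂ = p₂' := by
      funext u
      by_cases hu : u ∈ C
      · have : u ∉ B \ C := fun h => (mem_sdiff.1 h).2 hu
        rw [(mem_rootedTrees.1 h6).1 u this, (mem_rootedTrees.1 h6').1 u this]
      · have := congrFun heq u
        rwa [graft_of_notMem h4 hu, graft_of_notMem h4 hu] at this
    rw [e1, e2]
  · intro p hp
    obtain ⟨c, hc, hcv, hpc, hxc⟩ := exists_branch hp x hx hxv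
    obtain ⟨p₁, h₁, p₂, h₂, h⟩ := exists_eq_graft hp hc hcv hpc
    exact ⟨⟨descendants p c, c, p₁, p₂⟩, (hmem _).2 ⟨descendants_subset hp hc,
      root_notMem_descendants hp hcv, hxc, mem_descendants_iff.2 (Or.inl rfl), h₁, h₂⟩, h⟩
  · rintro ⟨C, c, p₁, p₂⟩ ha
    obtain ⟨h1, h2, -, h4, h5, h6⟩ := (hmem _).1 ha
    dsimp only at h1 h2 h4 h5 h6 ⊢
    have hsplit : B.erase v = C ∪ (B \ C).erase v := by
      ext u
      simp only [mem_erase, mem_union, mem_sdiff]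
      constructor
      · tauto
      · rintro (h | h)
        · exact ⟨fun e => h2 (e ▸ h), h1 h⟩
        · exact ⟨h.1, h.2.1⟩
    have hdisj : Disjoint C ((B \ C).erase v) :=
      disjoint_left.2 fun u hu h => (mem_sdiff.1 (mem_of_mem_erase h)).2 hu
    rw [hsplit, prod_union hdisj, ← mul_prod_erase C _ h4,
      descendants_graft_of_mem h1 hv h2 h4 h5 h6 h4, descendants_root h4 h5, graft_root]
    congr 1
    · congr 1
      refine prod_congr rfl fun w hw => ?_
      rw [descendants_graft_of_mem h1 hv h2 h4 h5 h6 (mem_of_mem_erase hw),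
        graft_of_mem (mem_of_mem_erase hw) (ne_of_mem_erase hw)]
    · refine prod_congr rfl fun w hw => ?_
      have hw' := mem_of_mem_erase hw
      rw [descendants_graft_of_notMem h1 hv h2 h4 h5 h6 hw' (ne_of_mem_erase hw),
        graft_of_notMem h4 (mem_sdiff.1 hw').2]

end RootedTrees

/-! ### Connected spanning subgraphs -/

section Edges

variable {V E : Type*} {ends : E → Sym2 V}

/-- `a` and `b` are joined by a path using only edges of `S`. -/
def JoinedBy (ends : E → Sym2 V) (S : Finset E) (a b : V) : Prop :=
  Relation.ReflTransGen (fun a b => ∃ e ∈ S, ends e = s(a, b)) a b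

lemma JoinedBy.edge {S : Finset E} {a b : V} {e : E} (he : e ∈ S) (h : ends e = s(a, b)) :
    JoinedBy ends S a b :=
  Relation.ReflTransGen.single ⟨e, he, h⟩

lemma JoinedBy.mono {S T : Finset E} (hST : S ⊆ T) {a b : V} (h : JoinedBy ends S a b) :
    JoinedBy ends T a b :=
  Relation.ReflTransGen.mono (fun _ _ ⟨e, he, h⟩ => ⟨e, hST he, h⟩) _ _ h

lemma JoinedBy.symm {S : Finset E} {a b : V} (h : JoinedBy ends S a b) : JoinedBy ends S b a := by
  induction h with
  | refl => exact Relation.ReflTransGen.refl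
  | tail _ h ih =>
    obtain ⟨e, he, h⟩ := h
    exact Relation.ReflTransGen.head ⟨e, he, h.trans Sym2.eq_swap⟩ ih

lemma sConnectedOn_iff {B : Finset V} {S : Finset E} {v : V} (hv : v ∈ B) :
    SConnectedOn ends B S ↔ ∀ u ∈ B, JoinedBy ends S u v :=
  ⟨fun h u hu => h u hu v hv, fun h a ha b hb => Relation.ReflTransGen.trans (h a ha) (h b hb).symm⟩

variable [Fintype E]

/-- The edges joining `v` to a vertex of `C`. -/
def edgesTo (ends : E → Sym2 V) (C : Finset V) (v : V) : Finset E :=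
  univ.filter fun e => ∃ b ∈ C, ends e = s(v, b)

lemma mem_edgesIn_iff {B : Finset V} {e : E} {a b : V} (h : ends e = s(a, b)) :
    e ∈ edgesIn ends B ↔ a ∈ B ∧ b ∈ B := by
  simp [edgesIn, h]

lemma mem_edgesTo {C : Finset V} {v : V} {e : E} :
    e ∈ edgesTo ends C v ↔ ∃ b ∈ C, ends e = s(v, b) := by
  simp [edgesTo]

lemma mem_edgesTo_iff {C : Finset V} {v : V} {e : E} {a b : V} (h : ends e = s(a, b)) :
    e ∈ edgesTo ends C v ↔ (a = v ∧ b ∈ C) ∨ (b = v ∧ a ∈ C) := by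
  rw [mem_edgesTo]
  simp only [h, Sym2.eq_iff]
  constructor
  · rintro ⟨c, hc, ⟨rfl, rfl⟩ | ⟨rfl, rfl⟩⟩
    · exact Or.inl ⟨rfl, hc⟩
    · exact Or.inr ⟨rfl, hc⟩
  · rintro (⟨rfl, hb⟩ | ⟨rfl, ha⟩)
    · exact ⟨b, hb, Or.inl ⟨rfl, rfl⟩⟩
    · exact ⟨a, ha, Or.inr ⟨rfl, rfl⟩⟩

/-- Sum of `t ^ #S` over the connected spanning subgraphs `(B, S)`. -/
def connSum {R : Type*} [CommSemiring R] (ends : E → Sym2 V) (t : R) (B : Finset V) : R :=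
  ∑ S ∈ (edgesIn ends B).powerset.filter (fun S => SConnectedOn ends B S), t ^ S.card

variable [DecidableEq V] {B C : Finset V} {v x : V} {S₁ T S₂ : Finset E}

lemma mem_edges_cases (hv : v ∈ B) (hvC : v ∉ C) (hCB : C ⊆ B) (e : E) :
    (e ∈ edgesIn ends C → e ∈ edgesIn ends B ∧ e ∉ edgesTo ends C v ∧
      e ∉ edgesIn ends (B \ C)) ∧
    (e ∈ edgesTo ends C v → e ∈ edgesIn ends B ∧ e ∉ edgesIn ends C ∧
      e ∉ edgesIn ends (B \ C)) ∧
    (e ∈ edgesIn ends (B \ C) → e ∈ edgesIn ends B ∧ e ∉ edgesIn ends C ∧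
      e ∉ edgesTo ends C v) := by
  obtain ⟨⟨a, b⟩, h⟩ := Quot.exists_rep (ends e)
  have h : ends e = s(a, b) := h.symm
  simp only [mem_edgesIn_iff h, mem_edgesTo_iff h, mem_sdiff]
  refine ⟨?_, ?_, ?_⟩
  · rintro ⟨ha, hb⟩
    have ha' : a ≠ v := fun h => hvC (h ▸ ha)
    have hb' : b ≠ v := fun h => hvC (h ▸ hb)
    exact ⟨⟨hCB ha, hCB hb⟩, by tauto, by tauto⟩
  · rintro (⟨rfl, hb⟩ | ⟨rfl, ha⟩)
    · exact ⟨⟨hv, hCB hb⟩, by tauto, by tauto⟩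
    · exact ⟨⟨hCB ha, hv⟩, by tauto, by tauto⟩
  · rintro ⟨ha, hb⟩
    exact ⟨⟨ha.1, hb.1⟩, by tauto, by tauto⟩

/-- The component of `x` after deleting the vertex `v`. -/
def componentAvoiding [Fintype V] (ends : E → Sym2 V) (S : Finset E) (v x : V) : Finset V :=
  univ.filter fun u => Relation.ReflTransGen
    (fun a b => a ≠ v ∧ b ≠ v ∧ ∃ e ∈ S, ends e = s(a, b)) x u

lemma componentAvoiding_union [Fintype V] (hvC : v ∉ C) (hxC : x ∈ C)
    (hS₁ : S₁ ⊆ edgesIn ends C) (hT : T ⊆ edgesTo ends C v) (hS₂ : S₂ ⊆ edgesIn ends (B \ C))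
    (h₁ : SConnectedOn ends C S₁) : componentAvoiding ends (S₁ ∪ T ∪ S₂) v x = C := by
  ext u
  simp only [componentAvoiding, mem_filter, mem_univ, true_and]
  constructor
  · intro h
    induction h with
    | refl => exact hxC
    | @tail a b _ h ih =>
      obtain ⟨ha, hb, e, he, h⟩ := h
      rcases mem_union.1 he with he | he
      · rcases mem_union.1 he with he | he
        · exact ((mem_edgesIn_iff h).1 (hS₁ he)).2
        · rcases (mem_edgesTo_iff h).1 (hT he) with h' | h'
          · exact h'.2
          · exact absurd h'.1 hb
      · exact absurd ih (mem_sdiff.1 ((mem_edgesIn_iff h).1 (hS₂ he)).1).2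
  · intro hu
    refine Relation.ReflTransGen.mono ?_ _ _ (h₁ x hxC u hu)
    rintro a b ⟨e, he, h⟩
    obtain ⟨ha, hb⟩ := (mem_edgesIn_iff h).1 (hS₁ he)
    exact ⟨fun h => hvC (h ▸ ha), fun h => hvC (h ▸ hb), e, by simp [he], h⟩

lemma sConnectedOn_union (hv : v ∈ B) (hvC : v ∉ C)
    (hT : T ⊆ edgesTo ends C v) (hTne : T.Nonempty)
    (h₁ : SConnectedOn ends C S₁) (h₂ : SConnectedOn ends (B \ C) S₂) :
    SConnectedOn ends B (S₁ ∪ T ∪ S₂) := by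
  rw [sConnectedOn_iff hv]
  intro u hu
  by_cases huC : u ∈ C
  · obtain ⟨e, he⟩ := hTne
    obtain ⟨c, hc, h⟩ := mem_edgesTo.1 (hT he)
    have hcv : JoinedBy ends (S₁ ∪ T ∪ S₂) c v :=
      JoinedBy.edge (e := e) (by simp [he]) (h.trans Sym2.eq_swap)
    exact Relation.ReflTransGen.trans
      (JoinedBy.mono (by intro e he; simp [he]) (h₁ u huC c hc)) hcv
  · exact JoinedBy.mono (by intro e he; simp [he])
      (h₂ u (mem_sdiff.2 ⟨hu, huC⟩) v (mem_sdiff.2 ⟨hv, hvC⟩))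

/-- Every connected subgraph splits along the component of `x` avoiding `v`. -/
lemma exists_eq_union [Fintype V] (hv : v ∈ B) (hx : x ∈ B) (hxv : x ≠ v) {S : Finset E}
    (hS : S ⊆ edgesIn ends B) (hconn : SConnectedOn ends B S) :
    ∃ C : Finset V, C ⊆ B ∧ v ∉ C ∧ x ∈ C ∧
      (∃ S₁ T S₂ : Finset E, S₁ ⊆ edgesIn ends C ∧ SConnectedOn ends C S₁ ∧
        T ⊆ edgesTo ends C v ∧ T.Nonempty ∧ S₂ ⊆ edgesIn ends (B \ C) ∧
        SConnectedOn ends (B \ C) S₂ ∧ S₁ ∪ T ∪ S₂ = S) := by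
  set C := componentAvoiding ends S v x with hC
  have hxC : x ∈ C := by
    simp only [hC, componentAvoiding, mem_filter, mem_univ, true_and]
    exact Relation.ReflTransGen.refl
  have hcl : ∀ e ∈ S, ∀ a b, ends e = s(a, b) → a ∈ C → b ≠ v → a ≠ v → b ∈ C := by
    intro e he a b h ha hb hav
    simp only [hC, componentAvoiding, mem_filter, mem_univ, true_and] at ha ⊢
    exact ha.tail ⟨hav, hb, e, he, h⟩
  have hind : ∀ u ∈ C, u ∈ B ∧ u ≠ v ∧ JoinedBy ends (S ∩ edgesIn ends C) x u := by
    intro u hu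
    have hu' := hu
    simp only [hC, componentAvoiding, mem_filter, mem_univ, true_and] at hu'
    clear hu
    induction hu' with
    | refl => exact ⟨hx, hxv, Relation.ReflTransGen.refl⟩
    | @tail a b hxa h ih =>
      obtain ⟨ha, hb, e, he, h⟩ := h
      have haC : a ∈ C := by
        simp only [hC, componentAvoiding, mem_filter, mem_univ, true_and]
        exact hxa
      have hbC := hcl e he a b h haC hb ha
      exact ⟨((mem_edgesIn_iff h).1 (hS he)).2, hb, Relation.ReflTransGen.tail ih.2.2
        ⟨e, mem_inter.2 ⟨he, (mem_edgesIn_iff h).2 ⟨haC, hbC⟩⟩, h⟩⟩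
  have hCB : C ⊆ B := fun u hu => (hind u hu).1
  have hvC : v ∉ C := fun h => (hind v h).2.1 rfl
  have hvBC : v ∈ B \ C := mem_sdiff.2 ⟨hv, hvC⟩
  refine ⟨C, hCB, hvC, hxC, S ∩ edgesIn ends C, S ∩ edgesTo ends C v, S ∩ edgesIn ends (B \ C),
    inter_subset_right, ?_, inter_subset_right, ?_, inter_subset_right, ?_, ?_⟩
  · rw [sConnectedOn_iff hxC]
    exact fun u hu => (hind u hu).2.2.symm
  · by_contra hne
    rw [not_nonempty_iff_eq_empty] at hne
    suffices h : ∀ u, JoinedBy ends S x u → u ∈ C from hvC (h v (hconn x hx v hv))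
    intro u hxu
    induction hxu with
    | refl => exact hxC
    | @tail a b _ h ih =>
      obtain ⟨e, he, h⟩ := h
      by_cases hbv : b = v
      · have : e ∈ S ∩ edgesTo ends C v :=
          mem_inter.2 ⟨he, (mem_edgesTo_iff h).2 (Or.inr ⟨hbv, ih⟩)⟩
        rw [hne] at this
        exact absurd this (notMem_empty e)
      · exact hcl e he a b h ih hbv (hind a ih).2.1
  · rw [sConnectedOn_iff hvBC]
    intro u hu
    have huC := (mem_sdiff.1 hu).2
    have huv : JoinedBy ends S u v := hconn u (mem_sdiff.1 hu).1 v hv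
    clear hu
    induction huv using Relation.ReflTransGen.head_induction_on with
    | refl => exact Relation.ReflTransGen.refl
    | @head a b h _ ih =>
      obtain ⟨e, he, h⟩ := h
      by_cases hav : a = v
      · rw [hav]
        exact Relation.ReflTransGen.refl
      · have hbC : b ∉ C := fun hb =>
          huC (hcl e he b a (h.trans Sym2.eq_swap) hb hav (hind b hb).2.1)
        obtain ⟨haB, hbB⟩ := (mem_edgesIn_iff h).1 (hS he)
        exact Relation.ReflTransGen.head ⟨e, mem_inter.2 ⟨he, (mem_edgesIn_iff h).2
          ⟨mem_sdiff.2 ⟨haB, huC⟩, mem_sdiff.2 ⟨hbB, hbC⟩⟩⟩, h⟩ (ih hbC)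
  · rw [← inter_union_distrib_left, ← inter_union_distrib_left]
    refine inter_eq_left.2 fun e he => ?_
    obtain ⟨⟨a, b⟩, h⟩ := Quot.exists_rep (ends e)
    have h : ends e = s(a, b) := h.symm
    have hB := (mem_edgesIn_iff h).1 (hS he)
    have h1 := hcl e he a b h
    have h2 := hcl e he b a (h.trans Sym2.eq_swap)
    have ha : a ∈ C → a ≠ v := fun h => (hind a h).2.1
    have hb : b ∈ C → b ≠ v := fun h => (hind b h).2.1
    simp only [mem_union, mem_edgesIn_iff h, mem_edgesTo_iff h, mem_sdiff]
    tauto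

/-- Recursion obtained by splitting off the component of `x` after deleting `v`. -/
lemma connSum_eq [Fintype V] {R : Type*} [CommSemiring R] (t : R)
    (hv : v ∈ B) (hx : x ∈ B) (hxv : x ≠ v) :
    connSum ends t B = ∑ C ∈ (B.erase v).powerset.filter (fun C => x ∈ C),
      connSum ends t C *
        (∑ T ∈ (edgesTo ends C v).powerset.filter (fun T => T.Nonempty), t ^ T.card) *
          connSum ends t (B \ C) := by
  have hrhs : ∀ C : Finset V, connSum ends t C *
        (∑ T ∈ (edgesTo ends C v).powerset.filter (fun T => T.Nonempty), t ^ T.card) *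
          connSum ends t (B \ C) =
      ∑ P ∈ ((edgesIn ends C).powerset.filter (fun S => SConnectedOn ends C S) ×ˢ
          (edgesTo ends C v).powerset.filter (fun T => T.Nonempty)) ×ˢ
            (edgesIn ends (B \ C)).powerset.filter (fun S => SConnectedOn ends (B \ C) S),
        t ^ P.1.1.card * t ^ P.1.2.card * t ^ P.2.card := by
    intro C
    rw [connSum, connSum, sum_mul_sum, ← sum_product', sum_mul_sum, ← sum_product']
  simp only [hrhs]
  simp only [sum_sigma']
  symm
  have hmem : ∀ a : (_ : Finset V) × ((Finset E × Finset E) × Finset E),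
      a ∈ ((B.erase v).powerset.filter (fun C => x ∈ C)).sigma (fun C =>
        ((edgesIn ends C).powerset.filter (fun S => SConnectedOn ends C S) ×ˢ
          (edgesTo ends C v).powerset.filter (fun T => T.Nonempty)) ×ˢ
            (edgesIn ends (B \ C)).powerset.filter (fun S => SConnectedOn ends (B \ C) S)) ↔
      a.1 ⊆ B ∧ v ∉ a.1 ∧ x ∈ a.1 ∧ a.2.1.1 ⊆ edgesIn ends a.1 ∧ SConnectedOn ends a.1 a.2.1.1 ∧
        a.2.1.2 ⊆ edgesTo ends a.1 v ∧ a.2.1.2.Nonempty ∧ a.2.2 ⊆ edgesIn ends (B \ a.1) ∧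
        SConnectedOn ends (B \ a.1) a.2.2 := by
    intro a
    simp only [mem_sigma, mem_filter, mem_powerset, mem_product, subset_erase]
    tauto
  refine sum_bij (fun a _ => a.2.1.1 ∪ a.2.1.2 ∪ a.2.2) ?_ ?_ ?_ ?_
  · intro a ha
    obtain ⟨h1, h2, -, h4, h5, h6, h7, h8, h9⟩ := (hmem a).1 ha
    have hc := mem_edges_cases (ends := ends) hv h2 h1
    refine mem_filter.2 ⟨mem_powerset.2 (union_subset (union_subset ?_ ?_) ?_),
      sConnectedOn_union hv h2 h6 h7 h5 h9⟩
    · exact fun e he => ((hc e).1 (h4 he)).1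
    · exact fun e he => ((hc e).2.1 (h6 he)).1
    · exact fun e he => ((hc e).2.2 (h8 he)).1
  · rintro ⟨C, ⟨S₁, T⟩, S₂⟩ ha ⟨C', ⟨S₁', T'⟩, S₂'⟩ ha' heq
    obtain ⟨h1, h2, h3, h4, h5, h6, h7, h8, h9⟩ := (hmem _).1 ha
    obtain ⟨h1', h2', h3', h4', h5', h6', h7', h8', h9'⟩ := (hmem _).1 ha'
    dsimp only at h1 h2 h3 h4 h5 h6 h7 h8 h9 h1' h2' h3' h4' h5' h6' h7' h8' h9' heq
    have hCC : C = C' := by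
      rw [← componentAvoiding_union h2 h3 h4 h6 h8 h5, heq,
        componentAvoiding_union h2' h3' h4' h6' h8' h5']
    subst hCC
    have hc := mem_edges_cases (ends := ends) hv h2 h1
    have e1 : S₁ = S₁' := by
      ext e
      have := Finset.ext_iff.1 heq e
      simp only [mem_union] at this
      grind
    have e2 : T = T' := by
      ext e
      have := Finset.ext_iff.1 heq e
      simp only [mem_union] at this
      grind
    have e3 : S₂ = S₂' := by
      ext e
      have := Finset.ext_iff.1 heq e
      simp only [mem_union] at this
      grind
    rw [e1, e2, e3]
  · intro S hS
    obtain ⟨hS, hconn⟩ := mem_filter.1 hS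
    obtain ⟨C, h1, h2, h3, S₁, T, S₂, h4, h5, h6, h7, h8, h9, h⟩ :=
      exists_eq_union hv hx hxv (mem_powerset.1 hS) hconn
    exact ⟨⟨C, ⟨S₁, T⟩, S₂⟩, (hmem _).2 ⟨h1, h2, h3, h4, h5, h6, h7, h8, h9⟩, h⟩
  · rintro ⟨C, ⟨S₁, T⟩, S₂⟩ ha
    obtain ⟨h1, h2, -, h4, -, h6, -, h8, -⟩ := (hmem _).1 ha
    dsimp only at h1 h2 h4 h6 h8 ⊢
    have hc := mem_edges_cases (ends := ends) hv h2 h1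
    have d1 : Disjoint S₁ T :=
      disjoint_left.2 fun e he he' => ((hc e).1 (h4 he)).2.1 (h6 he')
    have d2 : Disjoint (S₁ ∪ T) S₂ := by
      refine disjoint_left.2 fun e he he' => ?_
      rcases mem_union.1 he with he | he
      · exact ((hc e).1 (h4 he)).2.2 (h8 he')
      · exact ((hc e).2.1 (h6 he)).2.2 (h8 he')
    rw [card_union_of_disjoint d2, card_union_of_disjoint d1, pow_add, pow_add]

lemma card_edgesTo (ends : E → Sym2 V) (C : Finset V) (v : V) :
    (edgesTo ends C v).card = ∑ u ∈ C, eCnt ends u v := by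
  have : edgesTo ends C v = C.biUnion fun u => univ.filter fun e => ends e = s(u, v) := by
    ext e
    simp only [mem_edgesTo, mem_filter, mem_univ, true_and, mem_biUnion, Sym2.eq_swap (a := v)]
  rw [this, card_biUnion]
  · refine sum_congr rfl fun u _ => ?_
    rw [eCnt]
    congr
  · intro a _ b _ hab
    refine disjoint_left.2 fun e he he' => hab ?_
    have h := (mem_filter.1 he).2.symm.trans (mem_filter.1 he').2
    exact Sym2.congr_left.1 h

lemma connSum_singleton {R : Type*} [CommSemiring R] (ends : E → Sym2 V) (t : R) (v : V) :
    connSum ends t {v} = (t + 1) ^ eCnt ends v v := by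
  have h1 : (edgesIn ends {v}).powerset.filter (fun S => SConnectedOn ends {v} S) =
      (edgesIn ends {v}).powerset := by
    refine filter_true_of_mem fun S _ => (sConnectedOn_iff (mem_singleton_self v)).2 fun u hu => ?_
    rw [mem_singleton.1 hu]
    exact Relation.ReflTransGen.refl
  have h2 : edgesIn ends {v} = univ.filter fun e => ends e = s(v, v) := by
    ext e
    obtain ⟨⟨a, b⟩, h⟩ := Quot.exists_rep (ends e)
    have h : ends e = s(a, b) := h.symm
    rw [mem_edgesIn_iff h]
    simp [h]
  have h3 : (edgesIn ends {v}).card = eCnt ends v v := by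
    rw [h2, eCnt]
    congr
  rw [connSum, h1, ← h3, ← sum_pow_mul_eq_add_pow]
  simp

end Edges

/-! ### Comparison of the two recursions -/

/-- The weight of the branch `D` attached by its vertex `w` to `a`. -/
def branchWeight {V R : Type*} [LinearOrder V] [CommSemiring R] (e : V → V → ℕ) (q : R)
    (D : Finset V) (w a : V) : R :=
  if 0 < e w a ∧ ∀ u ∈ D, 0 < e u a → w ≤ u then nq q (∑ u ∈ D, e u a) else 0

lemma sum_branchWeight {V R : Type*} [LinearOrder V] [CommSemiring R] (e : V → V → ℕ) (q : R)
    (C : Finset V) (a : V) :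
    ∑ c ∈ C, branchWeight e q C c a = nq q (∑ u ∈ C, e u a) := by
  rcases (C.filter fun u => 0 < e u a).eq_empty_or_nonempty with h | h
  · have h0 : ∀ u ∈ C, e u a = 0 := by
      intro u hu
      have := filter_eq_empty_iff.1 h hu
      omega
    rw [sum_eq_zero h0, sum_eq_zero]
    · simp [nq]
    · intro c hc
      simp [branchWeight, h0 c hc]
  · set m := (C.filter fun u => 0 < e u a).min' h with hm
    obtain ⟨hmC, hma⟩ := mem_filter.1 (min'_mem _ h)
    have hle : ∀ u ∈ C, 0 < e u a → m ≤ u := fun u hu hua =>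
      min'_le _ u (mem_filter.2 ⟨hu, hua⟩)
    rw [sum_eq_single_of_mem m hmC]
    · rw [branchWeight, if_pos ⟨hma, hle⟩]
    · intro c hc hcm
      refine if_neg fun hcc => hcm ?_
      exact le_antisymm (hcc.2 m hmC hma) (hle c hc hcc.1)

lemma mul_nq {R : Type*} [CommRing R] (q : R) (m : ℕ) : (q - 1) * nq q m = q ^ m - 1 :=
  mul_geom_sum q m

lemma sum_nonempty_pow_card {E R : Type*} [CommRing R] (F : Finset E) (q : R) :
    ∑ T ∈ F.powerset.filter (fun T => T.Nonempty), (q - 1) ^ T.card = q ^ F.card - 1 := by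
  have h := sum_filter_add_sum_filter_not F.powerset (fun T => T.Nonempty)
    (fun T => (q - 1) ^ T.card)
  have h1 : F.powerset.filter (fun T => ¬ T.Nonempty) = {∅} := by
    ext T
    simp only [mem_filter, mem_powerset, not_nonempty_iff_eq_empty, mem_singleton]
    exact ⟨fun h => h.2, fun h => ⟨h ▸ empty_subset _, h⟩⟩
  have h2 : ∑ T ∈ F.powerset, (q - 1) ^ T.card = q ^ F.card := by
    have := sum_pow_mul_eq_add_pow (q - 1) 1 F
    simpa using this
  rw [h1, h2] at h
  rw [← h]
  simp

theorem connSum_eq_treeSum {V E R : Type*} [Fintype V] [LinearOrder V] [Fintype E] [CommRing R]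
    (ends : E → Sym2 V) (q : R) (n : ℕ) (B : Finset V) (hB : B.card = n + 1) (v : V) (hv : v ∈ B) :
    connSum ends (q - 1) B = (q - 1) ^ n * (q ^ (∑ i ∈ B, eCnt ends i i) *
      treeSum (branchWeight (eCnt ends) q) B v) := by
  induction n using Nat.strong_induction_on generalizing B v with
  | _ n ih =>
  by_cases hBv : B = {v}
  · subst hBv
    have : n = 0 := by simpa using hB
    simp [this, connSum_singleton, treeSum_singleton]
  obtain ⟨x, hx, hxv⟩ : ∃ x ∈ B, x ≠ v := by
    by_contra! h
    exact hBv (eq_singleton_iff_unique_mem.2 ⟨hv, h⟩)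
  rw [connSum_eq (q - 1) hv hx hxv, treeSum_eq _ hv hx hxv, mul_sum, mul_sum]
  refine sum_congr rfl fun C hC => ?_
  simp only [mem_filter, mem_powerset, subset_erase] at hC
  obtain ⟨⟨hCB, hvC⟩, hxC⟩ := hC
  have hcard := card_sdiff_add_card_eq_card hCB
  obtain ⟨k, hk⟩ : ∃ k, C.card = k + 1 :=
    Nat.exists_eq_succ_of_ne_zero (card_ne_zero_of_mem hxC)
  obtain ⟨l, hl⟩ : ∃ l, (B \ C).card = l + 1 :=
    Nat.exists_eq_succ_of_ne_zero (card_ne_zero_of_mem (mem_sdiff.2 ⟨hv, hvC⟩))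
  obtain rfl : n = k + l + 1 := by omega
  have hloops : ∑ i ∈ B, eCnt ends i i =
      ∑ i ∈ C, eCnt ends i i + ∑ i ∈ B \ C, eCnt ends i i := by
    rw [add_comm, sum_sdiff hCB]
  rw [sum_nonempty_pow_card, card_edgesTo, ← mul_nq, ← sum_branchWeight, mul_sum, mul_sum,
    sum_mul, mul_sum, mul_sum]
  refine sum_congr rfl fun c hc => ?_
  rw [ih k (by omega) C hk c hc, ih l (by omega) (B \ C) hl v (mem_sdiff.2 ⟨hv, hvC⟩), hloops]
  ring

/-- **Lemma 3.3 combined with Proposition 3.1**: the tree-product formula for the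
Tutte specialization `T_G(1,q)`. For a multigraph `G` on `Fin (r+1)` rooted at `0`,
`Σ_{S ⊆ E, (V,S) connected} (q-1)^{#S}
  = (q-1)^{#V-1} q^{ℓ(G)} Σ_{T : κ(T) = 0} Π_{w ≠ root} [δ_T(w)]_q`. -/
theorem stmt5 (r : ℕ) {E : Type*} [Fintype E] (ends : E → Sym2 (Fin (r+1))) :
    ∑ S ∈ (univ : Finset E).powerset.filter (fun S => SConnected ends S),
        ((Polynomial.X : Polynomial ℤ) - 1) ^ S.card =
      ((Polynomial.X : Polynomial ℤ) - 1) ^ r *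
        ((Polynomial.X : Polynomial ℤ) ^ (∑ i, eCnt ends i i) *
          ∑ p ∈ (parentMaps (eCnt ends)).filter
              (fun p => ∀ i j, ¬ isKappaInv (eCnt ends) p i j),
            ∏ w ∈ (univ : Finset (Fin (r+1))).erase 0,
              nq (Polynomial.X : Polynomial ℤ) (deltaStat (eCnt ends) p w)) := by
  have hconn : ∀ S : Finset E, SConnected ends S ↔ SConnectedOn ends univ S := fun S =>
    ⟨fun h v _ w _ => h v w, fun h v w => h v (mem_univ v) w (mem_univ w)⟩
  have hedges : edgesIn ends univ = univ := by
    ext e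
    simp [edgesIn]
  have h := connSum_eq_treeSum ends (Polynomial.X : Polynomial ℤ) r univ (by simp) 0 (mem_univ 0)
  rw [connSum, hedges] at h
  simp only [hconn]
  refine h.trans ?_
  congr 2
  rw [treeSum]
  symm
  refine sum_subset_zero_on_sdiff ?_ ?_ ?_
  · intro p hp
    obtain ⟨-, h0, -, hr⟩ := mem_filter.1 (mem_filter.1 hp).1
    exact mem_rootedTrees.2 ⟨fun u hu => absurd (mem_univ u) hu, h0, fun u _ => mem_univ _,
      fun u _ => mem_descendants.2 (hr u)⟩
  · intro p hp
    obtain ⟨hp, hnot⟩ := mem_sdiff.1 hp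
    by_contra hne
    have hw : ∀ w, w ≠ 0 → 0 < eCnt ends w (p w) ∧
        ∀ u ∈ descendants p w, 0 < eCnt ends u (p w) → w ≤ u := by
      intro w hw
      by_contra hcon
      exact hne (prod_eq_zero (mem_erase.2 ⟨hw, mem_univ w⟩) (if_neg hcon))
    obtain ⟨-, h0, -, hr⟩ := mem_rootedTrees.1 hp
    refine hnot (mem_filter.2 ⟨mem_filter.2 ⟨mem_univ p, h0, fun w hw0 => ⟨?_, (hw w hw0).1⟩,
      fun w => mem_descendants.1 (hr w (mem_univ w))⟩, ?_⟩)
    · intro hpw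
      exact hw0 ((mem_descendants_iff_of_fixed hpw).1 (hr w (mem_univ w)))
    · rintro i j ⟨hi, -, -, hd, hji, -, he⟩
      exact absurd ((hw i hi).2 j (mem_descendants.2 hd) he) (not_le.2 hji)
  · intro p hp
    obtain ⟨hp, hκ⟩ := mem_filter.1 hp
    obtain ⟨-, h0, hne, hr⟩ := mem_filter.1 hp
    have hp' : p ∈ rootedTrees univ 0 := mem_rootedTrees.2
      ⟨fun u hu => absurd (mem_univ u) hu, h0, fun u _ => mem_univ _,
        fun u _ => mem_descendants.2 (hr u)⟩
    refine prod_congr rfl fun w hw => ?_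
    have hw0 := ne_of_mem_erase hw
    rw [branchWeight, if_pos]
    · rfl
    · refine ⟨(hne w hw0).2, fun u hu he => ?_⟩
      by_contra hlt
      have hu0 : u ≠ 0 := fun h => root_notMem_descendants hp' hw0 (h ▸ hu)
      have hlt := not_le.1 hlt
      refine hκ w u ⟨hw0, hu0, hlt.ne', mem_descendants.1 hu, hlt, ?_, he⟩
      exact fun hpw => parent_notMem_descendants hp' w (mem_univ w) hw0 (hpw.symm ▸ hu)

end
end

section
/- Let G = (V,E) be a multigraph with vertex set [r] = {1,…,r}, rooted at v = 1. Then, as polynomials in q, Σ_{S ⊆ E with (V,S) connected} (q−1)^{#S} = (q−1)^{r−1} · 𝓘_G(q). (This expresses the identity 𝓘_G(q) = T_G(1,q), equations (1.8)/(3.2) of the paper.) -/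
open Finset

open scoped Classical

noncomputable section

/-! ### Rooted forests encoded by parent maps -/

/-- `w` is reached from `u` by iterating the parent map `p`: `w` is `u` or an ancestor of `u`. -/
def IsDesc {V : Type*} (p : V → V) (u w : V) : Prop := ∃ k, p^[k] u = w

namespace IsDesc

variable {V : Type*} {p : V → V}

theorem refl (p : V → V) (u : V) : IsDesc p u u := ⟨0, rfl⟩

theorem step (p : V → V) (u : V) : IsDesc p u (p u) := ⟨1, rfl⟩

theorem trans {u v w : V} (h : IsDesc p u v) (h' : IsDesc p v w) : IsDesc p u w := by
  obtain ⟨k, rfl⟩ := h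
  obtain ⟨l, rfl⟩ := h'
  exact ⟨l + k, Function.iterate_add_apply p l k u⟩

theorem eq_or_parent {u w : V} (h : IsDesc p u w) : u = w ∨ IsDesc p (p u) w := by
  obtain ⟨_ | k, h⟩ := h
  · exact Or.inl h
  · exact Or.inr ⟨k, h⟩

/-- Induction along the path from a vertex up to its ancestor `w`. -/
theorem induction_up {w : V} {P : V → Prop} (base : P w)
    (ind : ∀ u, IsDesc p (p u) w → P (p u) → P u) {u : V} (h : IsDesc p u w) : P u := by
  obtain ⟨k, h⟩ := h
  induction k generalizing u with
  | zero => exact (show u = w from h) ▸ base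
  | succ k ih => exact ind u ⟨k, h⟩ (ih h)

theorem eq_of_fixed {u w : V} (hu : p u = u) (h : IsDesc p u w) : w = u := by
  obtain ⟨k, rfl⟩ := h
  exact Function.iterate_fixed hu k

theorem total {u v w : V} (hv : IsDesc p u v) (hw : IsDesc p u w) :
    IsDesc p v w ∨ IsDesc p w v := by
  obtain ⟨k, rfl⟩ := hv
  obtain ⟨l, rfl⟩ := hw
  rcases le_total k l with h | h
  · exact Or.inl ⟨l - k, by rw [← Function.iterate_add_apply, Nat.sub_add_cancel h]⟩
  · exact Or.inr ⟨k - l, by rw [← Function.iterate_add_apply, Nat.sub_add_cancel h]⟩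

/-- A proper descendant of `a` lies below a child of `a`. -/
theorem exists_child {u a : V} (h : IsDesc p u a) (hne : u ≠ a) :
    ∃ c, p c = a ∧ c ≠ a ∧ IsDesc p u c := by
  suffices H : u = a ∨ ∃ c, p c = a ∧ c ≠ a ∧ IsDesc p u c from H.resolve_left hne
  refine induction_up (P := fun u => u = a ∨ ∃ c, p c = a ∧ c ≠ a ∧ IsDesc p u c)
    (Or.inl rfl) (fun u _ ih => ?_) h
  by_cases hu : u = a
  · exact Or.inl hu
  rcases ih with ih | ⟨c, h1, h2, h3⟩
  · exact Or.inr ⟨u, ih, hu, refl p u⟩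
  · exact Or.inr ⟨c, h1, h2, (step p u).trans h3⟩

end IsDesc

/-- The parent map `p` encodes a tree rooted at `o`. -/
def IsRootedTree {V : Type*} (o : V) (p : V → V) : Prop := p o = o ∧ ∀ w, IsDesc p w o

namespace IsRootedTree

variable {V : Type*} {o : V} {p : V → V}

theorem isDesc_antisymm (hp : IsRootedTree o p) {u w : V} (h : IsDesc p u w)
    (h' : IsDesc p w u) : u = w := by
  obtain ⟨k, rfl⟩ := h
  obtain ⟨l, h'⟩ := h'
  obtain ⟨m, hm⟩ := hp.2 u
  rcases Nat.eq_zero_or_pos (l + k) with hk | hk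
  · rw [(Nat.add_eq_zero_iff.1 hk).2]; rfl
  rw [← Function.iterate_add_apply] at h'
  have hper : p^[(l + k) * m] u = u := by
    rw [Function.iterate_mul]; exact Function.iterate_fixed h' m
  have ho : p^[(l + k) * m] u = o := by
    have : (l + k) * m = ((l + k) * m - m) + m :=
      (Nat.sub_add_cancel (Nat.le_mul_of_pos_left m hk)).symm
    rw [this, Function.iterate_add_apply, hm]
    exact Function.iterate_fixed hp.1 _
  obtain rfl : u = o := hper.symm.trans ho
  exact (Function.iterate_fixed hp.1 k).symm

theorem parent_ne (hp : IsRootedTree o p) {w : V} (hw : w ≠ o) : p w ≠ w := fun h =>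
  hw (IsDesc.eq_of_fixed h (hp.2 w)).symm

theorem not_isDesc_parent (hp : IsRootedTree o p) {w : V} (hw : w ≠ o) : ¬ IsDesc p (p w) w :=
  fun h => hp.parent_ne hw (hp.isDesc_antisymm h (IsDesc.step p w))

theorem ne_root (hp : IsRootedTree o p) {u w : V} (hw : w ≠ o) (h : IsDesc p u w) : u ≠ o := by
  rintro rfl
  exact hw (IsDesc.eq_of_fixed hp.1 h)

theorem eq_of_parent_eq (hp : IsRootedTree o p) {u w : V} (hw : w ≠ o)
    (h : IsDesc p u w) (he : p u = p w) : u = w := by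
  rcases h.eq_or_parent with h | h
  · exact h
  · exact absurd (he ▸ h) (hp.not_isDesc_parent hw)

theorem eq_of_parent_eq_of_common (hp : IsRootedTree o p) {x u w : V} (hu : u ≠ o) (hw : w ≠ o)
    (hxu : IsDesc p x u) (hxw : IsDesc p x w) (he : p u = p w) : u = w := by
  rcases hxu.total hxw with h | h
  · exact hp.eq_of_parent_eq hw h he
  · exact (hp.eq_of_parent_eq hu h he.symm).symm

/-- A pair (parent of `i`, descendant of `i`) determines `i`, even as an unordered pair. -/
theorem sym2_inj (hp : IsRootedTree o p) {i i' j j' : V} (hi : i ≠ o) (hi' : i' ≠ o)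
    (hj : IsDesc p j i) (hj' : IsDesc p j' i') (h : s(p i, j) = s(p i', j')) :
    i = i' ∧ j = j' := by
  rcases Sym2.eq_iff.1 h with ⟨h1, rfl⟩ | ⟨rfl, rfl⟩
  · exact ⟨hp.eq_of_parent_eq_of_common hi hi' hj hj' h1, rfl⟩
  · exact absurd (hj'.trans ((IsDesc.step p i').trans hj)) (hp.not_isDesc_parent hi)

end IsRootedTree

/-! ### Neighbours-first spanning trees -/

/-- `a` has a child `c ≠ a` that is an ancestor of `b` (or `b` itself) with `b ≤ c`. -/
def IsGoodPair {V : Type*} [LE V] (p : V → V) (a b : V) : Prop :=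
  ∃ c, p c = a ∧ c ≠ a ∧ IsDesc p b c ∧ b ≤ c

/-- The tree encoded by `p`, rooted at `o`, uses only edges of the relation `R`, every edge of `R`
joins a vertex to one of its ancestors, and each vertex `c` is the largest vertex among its
descendants that is joined by `R` to the parent of `c`. -/
structure IsNeighborTree {V : Type*} [LE V] (R : V → V → Prop) (o : V) (p : V → V) : Prop where
  isRootedTree : IsRootedTree o p
  rel_parent : ∀ w, w ≠ o → R w (p w)
  good : ∀ a b, R a b → a = b ∨ IsGoodPair p a b ∨ IsGoodPair p b a

namespace IsNeighborTree

variable {V : Type*} [LinearOrder V] {R : V → V → Prop} {o : V} {p p' : V → V}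

theorem comparable (hp : IsNeighborTree R o p) {x y : V} (h : R x y) :
    IsDesc p x y ∨ IsDesc p y x := by
  rcases hp.good x y h with rfl | ⟨c, rfl, -, hc, -⟩ | ⟨c, rfl, -, hc, -⟩
  · exact Or.inl (IsDesc.refl p x)
  · exact Or.inr (hc.trans (IsDesc.step p c))
  · exact Or.inl (hc.trans (IsDesc.step p c))

theorem isDesc_of_rel (hp : IsNeighborTree R o p) {w x y : V} (hx : IsDesc p x w)
    (hy : IsDesc p y (p w)) (hne : y ≠ p w) (h : R x y) : IsDesc p y w := by
  rcases hp.comparable h with hxy | hyx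
  · rcases hx.total hxy with hwy | hyw
    · rcases hwy.eq_or_parent with rfl | hwy
      · exact IsDesc.refl p w
      · exact absurd (hp.isRootedTree.isDesc_antisymm hy hwy) hne
    · exact hyw
  · exact hyx.trans hx

theorem isDesc_of_isDesc (hp : IsNeighborTree R o p) (hp' : IsNeighborTree R o p')
    (hsymm : ∀ a b, R a b → R b a) {a w c : V} (hD : ∀ x, IsDesc p x a ↔ IsDesc p' x a)
    (hw : w ≠ o) (hwa : p w = a) (hca : p' c = a) (hwc : IsDesc p' w c) {x : V}
    (hx : IsDesc p x w) : IsDesc p' x c := by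
  subst hwa
  refine IsDesc.induction_up (p := p) (P := fun x => IsDesc p x w → IsDesc p' x c)
    (fun _ => hwc) (fun u hu ih _ => ?_) hx hx
  have huw : IsDesc p u w := (IsDesc.step p u).trans hu
  refine hp'.isDesc_of_rel (ih hu) ?_ ?_
    (hsymm _ _ (hp.rel_parent u (hp.isRootedTree.ne_root hw huw)))
  · exact hca ▸ (hD u).1 (huw.trans (IsDesc.step p w))
  · rintro rfl
    exact hp.isRootedTree.not_isDesc_parent hw (hca ▸ huw)

theorem le_of_isDesc (hp : IsNeighborTree R o p) {a w c : V} (hw : w ≠ o) (hwa : p w = a)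
    (hcw : IsDesc p c w) (hca : R c a) : c ≤ w := by
  subst hwa
  have hT := hp.isRootedTree
  have hn : ¬ IsDesc p (p w) c := fun h => hT.not_isDesc_parent hw (h.trans hcw)
  rcases hp.good c _ hca with rfl | ⟨d, hd, -, had, -⟩ | ⟨d, hd, hne, hcd, hle⟩
  · exact absurd (IsDesc.refl p _) hn
  · exact absurd (had.trans (hd ▸ IsDesc.step p d)) hn
  · have hdo : d ≠ o := by
      rintro rfl
      exact hne (hT.1.symm.trans hd)
    rwa [hT.eq_of_parent_eq_of_common hw hdo hcw hcd hd.symm]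

theorem unique (hp : IsNeighborTree R o p) (hp' : IsNeighborTree R o p')
    (hsymm : ∀ a b, R a b → R b a) : p = p' := by
  have hT := hp.isRootedTree
  have hT' := hp'.isRootedTree
  suffices H : ∀ w, (∀ x, IsDesc p x w ↔ IsDesc p' x w) ∧ p w = p' w from
    funext fun w => (H w).2
  intro w
  refine IsDesc.induction_up (p := p)
    (P := fun w => (∀ x, IsDesc p x w ↔ IsDesc p' x w) ∧ p w = p' w)
    ⟨fun x => iff_of_true (hT.2 x) (hT'.2 x), hT.1.trans hT'.1.symm⟩ (fun w _ ih => ?_) (hT.2 w)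
  by_cases hw : w = o
  · subst hw
    exact ⟨fun x => iff_of_true (hT.2 x) (hT'.2 x), hT.1.trans hT'.1.symm⟩
  have hD := ih.1
  obtain ⟨c, hc, hcne, hwc⟩ :=
    ((hD w).1 (IsDesc.step p w)).exists_child (hT.parent_ne hw).symm
  have hco : c ≠ o := by
    rintro rfl
    exact hcne (hT'.1.symm.trans hc)
  have hca : IsDesc p c (p w) := (hD c).2 (hc ▸ IsDesc.step p' c)
  obtain ⟨d, hd, hdne, hcd⟩ := hca.exists_child hcne
  have hdo : d ≠ o := by
    rintro rfl
    exact hdne (hT.1.symm.trans hd)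
  have hback : ∀ x, IsDesc p' x c → IsDesc p x d := fun x hx =>
    hp'.isDesc_of_isDesc hp hsymm (fun x => (hD x).symm) hco hc hd hcd hx
  obtain rfl : d = w :=
    hT.eq_of_parent_eq_of_common hdo hw (hback w hwc) (IsDesc.refl p w) hd
  obtain rfl : d = c := le_antisymm
    (hp'.le_of_isDesc hco hc hwc (hp.rel_parent d hw))
    (hp.le_of_isDesc hw rfl hcd (hc ▸ hp'.rel_parent c hco))
  exact ⟨fun x => ⟨fun hx => hp.isDesc_of_isDesc hp' hsymm hD hw rfl hc hwc hx, hback x⟩, hc.symm⟩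

end IsNeighborTree

theorem reflTransGen_symm {V : Type*} {R : V → V → Prop} (hsymm : ∀ a b, R a b → R b a) {a b : V}
    (h : Relation.ReflTransGen R a b) : Relation.ReflTransGen R b a := by
  induction h with
  | refl => exact .refl
  | tail _ h ih => exact .head (hsymm _ _ h) ih

section Existence

variable {V : Type*} [LinearOrder V] {R : V → V → Prop}

/-- Existence of a neighbours-first spanning tree on a finite set `B` of vertices that are all
joined to `v` inside `B`. -/
theorem exists_neighborTree_on (hsymm : ∀ a b, R a b → R b a) (n : ℕ) (B : Finset V)
    (hn : B.card = n) (v : V) (hv : v ∈ B)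
    (hB : ∀ u ∈ B, Relation.ReflTransGen (fun a b => R a b ∧ a ∈ B ∧ b ∈ B) u v) :
    ∃ p : V → V, p v = v ∧ (∀ w ∈ B, p w ∈ B) ∧ (∀ w ∈ B, IsDesc p w v) ∧
      (∀ w ∈ B, w ≠ v → R w (p w)) ∧
      ∀ a ∈ B, ∀ b ∈ B, R a b → a = b ∨ IsGoodPair p a b ∨ IsGoodPair p b a := by
  induction n using Nat.strong_induction_on generalizing B v with
  | _ n ih =>
  set R' : V → V → Prop := fun a b => R a b ∧ a ∈ B.erase v ∧ b ∈ B.erase v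
  have hR'symm : ∀ a b, R' a b → R' b a := fun a b h => ⟨hsymm _ _ h.1, h.2.2, h.2.1⟩
  set C : V → Finset V := fun u => (B.erase v).filter (Relation.ReflTransGen R' u) with hC
  have hCmem : ∀ u x, x ∈ C u ↔ x ∈ B.erase v ∧ Relation.ReflTransGen R' u x := fun u x => by
    simp only [hC, Finset.mem_filter]
  have hCself : ∀ u ∈ B.erase v, u ∈ C u := fun u hu => (hCmem u u).2 ⟨hu, .refl⟩
  have hCeq : ∀ u x, x ∈ C u → C x = C u := fun u x hx => by
    have hux := ((hCmem u x).1 hx).2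
    ext y
    rw [hCmem, hCmem]
    exact and_congr_right fun _ =>
      ⟨hux.trans, (reflTransGen_symm hR'symm hux).trans⟩
  have hCne : ∀ u ∈ B.erase v, ((C u).filter fun x => R x v).Nonempty := fun u hu => by
    have huv := hB u (Finset.mem_of_mem_erase hu)
    induction huv using Relation.ReflTransGen.head_induction_on with
    | refl => exact absurd rfl (Finset.ne_of_mem_erase hu)
    | @head a c h _ ihp =>
      by_cases hcv : c = v
      · exact ⟨a, Finset.mem_filter.2 ⟨hCself a hu, hcv ▸ h.1⟩⟩
      · have hc : c ∈ B.erase v := Finset.mem_erase.2 ⟨hcv, h.2.2⟩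
        rw [← hCeq a c ((hCmem a c).2 ⟨hc, .single ⟨h.1, hu, hc⟩⟩)]
        exact ihp hc
  have key : ∀ D : Finset V, ∃ (b : V) (p : V → V), (∃ u ∈ B.erase v, D = C u) →
      b ∈ D ∧ R b v ∧ (∀ x ∈ D, R x v → x ≤ b) ∧ p b = b ∧ (∀ w ∈ D, p w ∈ D) ∧
      (∀ w ∈ D, IsDesc p w b) ∧ (∀ w ∈ D, w ≠ b → R w (p w)) ∧
      ∀ x ∈ D, ∀ y ∈ D, R x y → x = y ∨ IsGoodPair p x y ∨ IsGoodPair p y x := by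
    intro D
    by_cases hD : ∃ u ∈ B.erase v, D = C u
    swap
    · exact ⟨v, id, fun h => absurd h hD⟩
    obtain ⟨u, hu, rfl⟩ := hD
    set b := ((C u).filter fun x => R x v).max' (hCne u hu)
    have hb := Finset.mem_filter.1 (Finset.max'_mem _ (hCne u hu))
    have hcard : (C u).card < n :=
      ((Finset.card_filter_le _ _).trans_lt (Finset.card_erase_lt_of_mem hv)).trans_eq hn
    have hpath : ∀ x ∈ C u,
        Relation.ReflTransGen (fun a b => R a b ∧ a ∈ C u ∧ b ∈ C u) x b := by
      intro x hx
      have hxb : Relation.ReflTransGen R' x b :=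
        (reflTransGen_symm hR'symm ((hCmem u x).1 hx).2).trans ((hCmem u b).1 hb.1).2
      induction hxb using Relation.ReflTransGen.head_induction_on with
      | refl => exact .refl
      | @head a c h _ ihp =>
        have hc : c ∈ C u := (hCmem u c).2 ⟨h.2.2, ((hCmem u a).1 hx).2.tail h⟩
        exact .head ⟨h.1, hx, hc⟩ (ihp hc)
    obtain ⟨p, hp⟩ := ih _ hcard (C u) rfl b hb.1 hpath
    exact ⟨b, p, fun _ => ⟨hb.1, hb.2, fun x hx hxv =>
      Finset.le_max' _ _ (Finset.mem_filter.2 ⟨hx, hxv⟩), hp⟩⟩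
  choose b p hbp using key
  set P : V → V := fun w => if w = v ∨ w = b (C w) then v else p (C w) w
  have hPv : P v = v := if_pos (Or.inl rfl)
  have hCv : ∀ u, v ∉ C u := fun u h => Finset.notMem_erase v B ((hCmem u v).1 h).1
  have hPb : ∀ u ∈ B.erase v, P (b (C u)) = v := fun u hu => by
    have := hCeq u _ (hbp (C u) ⟨u, hu, rfl⟩).1
    exact if_pos (Or.inr (by rw [this]))
  have hPp : ∀ u ∈ B.erase v, u ≠ b (C u) → P u = p (C u) u := fun u hu h =>
    if_neg (not_or.2 ⟨Finset.ne_of_mem_erase hu, h⟩)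
  have hCsub : ∀ u x, x ∈ C u → x ∈ B.erase v := fun u x hx => ((hCmem u x).1 hx).1
  have hdesc : ∀ u ∈ B.erase v, ∀ x ∈ C u, ∀ c, IsDesc (p (C u)) x c → IsDesc P x c := by
    intro u hu x hx c hxc
    obtain ⟨hb1, -, -, hpb, hpC, -, -, -⟩ := hbp (C u) ⟨u, hu, rfl⟩
    refine IsDesc.induction_up (P := fun x => x ∈ C u → IsDesc P x c)
      (fun _ => IsDesc.refl P c) (fun y hyc ihy hy => ?_) hxc hx
    by_cases hyb : y = b (C u)
    · subst hyb
      rw [hpb] at hyc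
      rw [IsDesc.eq_of_fixed hpb hyc]
      exact IsDesc.refl P _
    · have : P y = p (C u) y := by
        rw [hPp y (hCsub u y hy) (by rwa [hCeq u y hy]), hCeq u y hy]
      exact (IsDesc.step P y).trans (this ▸ ihy (hpC y hy))
  have hgood_v : ∀ u ∈ B.erase v, R u v → IsGoodPair P v u := fun u hu huv => by
    obtain ⟨hb1, -, hmax, -, -, hd, -, -⟩ := hbp (C u) ⟨u, hu, rfl⟩
    have hus := hCself u hu
    exact ⟨b (C u), hPb u hu, fun h => hCv u (h ▸ hb1), hdesc u hu u hus _ (hd u hus),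
      hmax u hus huv⟩
  have hgood : ∀ u ∈ B.erase v, ∀ x ∈ C u, ∀ y ∈ C u, IsGoodPair (p (C u)) x y →
      IsGoodPair P x y := by
    rintro u hu x hx y hy ⟨c, hc, hcx, hyc, hle⟩
    obtain ⟨-, -, -, hpb, hpC, -, -, -⟩ := hbp (C u) ⟨u, hu, rfl⟩
    have hcC : c ∈ C u := by
      obtain ⟨k, rfl⟩ := hyc
      exact Set.MapsTo.iterate (s := (C u : Set V)) hpC k hy
    have hcb : c ≠ b (C u) := by
      rintro rfl
      exact hcx (hpb.symm.trans hc)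
    refine ⟨c, ?_, hcx, hdesc u hu y hy c hyc, hle⟩
    rw [hPp c (hCsub u c hcC) (by rwa [hCeq u c hcC]), hCeq u c hcC, hc]
  refine ⟨P, hPv, fun w hw => ?_, fun w hw => ?_, fun w hw hwv => ?_, fun x hx y hy hxy => ?_⟩
  · by_cases h : w = v ∨ w = b (C w)
    · rw [show P w = v from if_pos h]; exact hv
    · have hw' : w ∈ B.erase v := Finset.mem_erase.2 ⟨fun h' => h (Or.inl h'), hw⟩
      rw [show P w = p (C w) w from if_neg h]
      exact Finset.mem_of_mem_erase
        (hCsub w _ ((hbp (C w) ⟨w, hw', rfl⟩).2.2.2.2.1 w (hCself w hw')))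
  · by_cases h : w = v
    · exact h ▸ IsDesc.refl P v
    · have hw' : w ∈ B.erase v := Finset.mem_erase.2 ⟨h, hw⟩
      have hws := hCself w hw'
      have := hdesc w hw' w hws _ ((hbp (C w) ⟨w, hw', rfl⟩).2.2.2.2.2.1 w hws)
      exact this.trans ⟨1, hPb w hw'⟩
  · have hw' : w ∈ B.erase v := Finset.mem_erase.2 ⟨hwv, hw⟩
    obtain ⟨-, hbv, -, -, -, -, hR, -⟩ := hbp (C w) ⟨w, hw', rfl⟩
    by_cases h : w = b (C w)
    · rw [show P w = v from if_pos (Or.inr h), h]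
      exact hbv
    · rw [hPp w hw' h]
      exact hR w (hCself w hw') h
  · by_cases hxv : x = v
    · by_cases hyv : y = v
      · exact Or.inl (hxv.trans hyv.symm)
      · subst hxv
        exact Or.inr (Or.inl (hgood_v y (Finset.mem_erase.2 ⟨hyv, hy⟩) (hsymm _ _ hxy)))
    have hx' : x ∈ B.erase v := Finset.mem_erase.2 ⟨hxv, hx⟩
    by_cases hyv : y = v
    · subst hyv
      exact Or.inr (Or.inr (hgood_v x hx' hxy))
    have hy' : y ∈ B.erase v := Finset.mem_erase.2 ⟨hyv, hy⟩
    have hxC := hCself x hx'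
    have hyC : y ∈ C x := (hCmem x y).2 ⟨hy', .single ⟨hxy, hx', hy'⟩⟩
    exact ((hbp (C x) ⟨x, hx', rfl⟩).2.2.2.2.2.2.2 x hxC y hyC hxy).imp_right
      (Or.imp (hgood x hx' x hxC y hyC) (hgood x hx' y hyC x hxC))

/-- A connected relation on a finite linearly ordered vertex set has a unique neighbours-first
spanning tree with given root. -/
theorem existsUnique_isNeighborTree [Fintype V] (hsymm : ∀ a b, R a b → R b a) (o : V)
    (hconn : ∀ u, Relation.ReflTransGen R u o) : ∃! p, IsNeighborTree R o p := by
  obtain ⟨p, hpo, -, hdesc, hrel, hgood⟩ := exists_neighborTree_on hsymm _ Finset.univ rfl o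
    (Finset.mem_univ o) (by simpa using hconn)
  have hp : IsNeighborTree R o p :=
    ⟨⟨hpo, fun w => hdesc w (Finset.mem_univ w)⟩, fun w => hrel w (Finset.mem_univ w),
      fun a b => hgood a (Finset.mem_univ a) b (Finset.mem_univ b)⟩
  exact ⟨p, hp, fun p' hp' => hp'.unique hp hsymm⟩

theorem IsNeighborTree.reflTransGen {o : V} {p : V → V} (hp : IsNeighborTree R o p)
    (hsymm : ∀ a b, R a b → R b a) (u w : V) : Relation.ReflTransGen R u w := by
  have key : ∀ u, Relation.ReflTransGen R u o := fun u => by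
    refine IsDesc.induction_up (p := p) (P := fun u => Relation.ReflTransGen R u o) .refl
      (fun u _ ih => ?_) (hp.isRootedTree.2 u)
    by_cases hu : u = o
    · exact hu ▸ .refl
    · exact .head (hp.rel_parent u hu) ih
  exact (key u).trans (reflTransGen_symm hsymm (key w))

end Existence

/-! ### Generating functions of edge sets -/

section GeneratingFunction

variable {A E ι : Type*} [CommRing A]

theorem sum_powerset_union_mul {F G : Finset E} (hFG : Disjoint F G) (f g : Finset E → A) :
    ∑ S ∈ (F ∪ G).powerset, f (S ∩ F) * g (S ∩ G) =
      (∑ S ∈ F.powerset, f S) * ∑ S ∈ G.powerset, g S := by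
  have hU : ∀ {S T : Finset E}, S ⊆ F → T ⊆ G → (S ∪ T) ∩ F = S ∧ (S ∪ T) ∩ G = T := by
    intro S T hS hT
    have h1 : T ∩ F = ∅ := (hFG.symm.mono_left hT).eq_bot
    have h2 : S ∩ G = ∅ := (hFG.mono_left hS).eq_bot
    rw [union_inter_distrib_right, union_inter_distrib_right, h1, h2,
      inter_eq_left.2 hS, inter_eq_left.2 hT, union_empty, empty_union]
    exact ⟨rfl, rfl⟩
  rw [Finset.sum_mul_sum, ← Finset.sum_product']
  refine Finset.sum_nbij' (fun S => (S ∩ F, S ∩ G)) (fun x => x.1 ∪ x.2) ?_ ?_ ?_ ?_ ?_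
  · intro S _
    simp only [mem_product, mem_powerset]
    exact ⟨inter_subset_right, inter_subset_right⟩
  · intro x hx
    simp only [mem_product, mem_powerset] at hx
    exact mem_powerset.2 (union_subset_union hx.1 hx.2)
  · intro S hS
    show S ∩ F ∪ S ∩ G = S
    rw [← inter_union_distrib_left, inter_eq_left.2 (mem_powerset.1 hS)]
  · intro x hx
    simp only [mem_product, mem_powerset] at hx
    exact Prod.ext (hU hx.1 hx.2).1 (hU hx.1 hx.2).2
  · intro S _
    rfl

theorem sum_powerset_pow_card (F : Finset E) (x : A) :
    ∑ S ∈ F.powerset, x ^ S.card = (x + 1) ^ F.card := by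
  simpa using Finset.sum_pow_mul_eq_add_pow x 1 F

theorem sum_powerset_pow_card_nonempty (F : Finset E) (x : A) :
    (∑ S ∈ F.powerset, if S.Nonempty then x ^ S.card else 0) = (x + 1) ^ F.card - 1 := by
  rw [← sum_powerset_pow_card, eq_sub_iff_add_eq, ← Finset.sum_erase_add _ _ (empty_mem_powerset F),
    ← Finset.sum_erase_add (F.powerset) (fun S => x ^ S.card) (empty_mem_powerset F)]
  simp only [Finset.not_nonempty_empty, if_false, add_zero, card_empty, pow_zero]
  congr 1
  refine Finset.sum_congr rfl fun S hS => if_pos ?_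
  exact nonempty_iff_ne_empty.2 (ne_of_mem_erase hS)

/-- Generating function of the subsets of `F ∪ ⋃ i, T i` that meet every `T i`. -/
theorem sum_powerset_meeting (F : Finset E) (I : Finset ι) (T : ι → Finset E)
    (hF : ∀ i ∈ I, Disjoint F (T i)) (hT : ∀ i ∈ I, ∀ j ∈ I, i ≠ j → Disjoint (T i) (T j))
    (x : A) :
    (∑ S ∈ (F ∪ I.biUnion T).powerset,
        if ∀ i ∈ I, (S ∩ T i).Nonempty then x ^ S.card else 0) =
      (x + 1) ^ F.card * ∏ i ∈ I, ((x + 1) ^ (T i).card - 1) := by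
  induction I using Finset.induction_on with
  | empty => simp [sum_powerset_pow_card]
  | insert a I ha ih =>
    have hdisj : Disjoint (F ∪ I.biUnion T) (T a) := by
      rw [disjoint_union_left, disjoint_biUnion_left]
      exact ⟨hF a (mem_insert_self a I), fun i hi => hT i (mem_insert_of_mem hi) a
        (mem_insert_self a I) (ne_of_mem_of_not_mem hi ha)⟩
    have hU : F ∪ (insert a I).biUnion T = (F ∪ I.biUnion T) ∪ T a := by
      rw [biUnion_insert, union_comm (T a), union_assoc]
    rw [prod_insert ha, mul_comm (_ - 1), ← mul_assoc, ← ih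
      (fun i hi => hF i (mem_insert_of_mem hi))
      (fun i hi j hj => hT i (mem_insert_of_mem hi) j (mem_insert_of_mem hj)),
      ← sum_powerset_pow_card_nonempty, ← sum_powerset_union_mul hdisj, hU]
    refine sum_congr rfl fun S hS => ?_
    have hcard : S.card = (S ∩ (F ∪ I.biUnion T)).card + (S ∩ T a).card := by
      rw [← card_union_of_disjoint (hdisj.mono inter_subset_right inter_subset_right),
        ← inter_union_distrib_left, inter_eq_left.2 (mem_powerset.1 hS)]
    have hmeet : (∀ i ∈ insert a I, (S ∩ T i).Nonempty) ↔
        (∀ i ∈ I, (S ∩ (F ∪ I.biUnion T) ∩ T i).Nonempty) ∧ (S ∩ T a).Nonempty := by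
      rw [forall_mem_insert, and_comm]
      refine and_congr_left fun _ => forall₂_congr fun i hi => ?_
      rw [inter_assoc, inter_eq_right.2 ((subset_biUnion_of_mem T hi).trans subset_union_right)]
    rw [hcard, pow_add, ite_zero_mul_ite_zero]
    exact if_congr hmeet rfl rfl

end GeneratingFunction

/-! ### Edge sets with a given neighbours-first spanning tree -/

/-- The edges with endpoint set `{i, j}`. -/
def edgeClass {V E : Type*} [Fintype E] (ends : E → Sym2 V) (i j : V) : Finset E :=
  univ.filter fun e => ends e = s(i, j)

section EdgeSets

variable {r : ℕ} {E : Type*} [Fintype E] (ends : E → Sym2 (Fin (r+1)))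
  {p : Fin (r+1) → Fin (r+1)}

/-- The `κ`-inversions of the tree encoded by `p`. -/
def kappaInvs (e : Fin (r+1) → Fin (r+1) → ℕ) (p : Fin (r+1) → Fin (r+1)) :
    Finset (Fin (r+1) × Fin (r+1)) :=
  (univ ×ˢ univ).filter fun pr => isKappaInv e p pr.1 pr.2

/-- The loops, and the edges counted by `kappaStat`. -/
def freeEdges (p : Fin (r+1) → Fin (r+1)) : Finset E :=
  (univ.biUnion fun i => edgeClass ends i i) ∪
    (kappaInvs (eCnt ends) p).biUnion fun pr => edgeClass ends (p pr.1) pr.2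

theorem mem_edgeClass {e : E} {i j : Fin (r+1)} : e ∈ edgeClass ends i j ↔ ends e = s(i, j) := by
  simp [edgeClass]

theorem edgeClass_comm (i j : Fin (r+1)) : edgeClass ends i j = edgeClass ends j i := by
  ext e
  rw [mem_edgeClass, mem_edgeClass, Sym2.eq_swap]

theorem card_edgeClass (i j : Fin (r+1)) : (edgeClass ends i j).card = eCnt ends i j := rfl

theorem disjoint_edgeClass {i j i' j' : Fin (r+1)} (h : s(i, j) ≠ s(i', j')) :
    Disjoint (edgeClass ends i j) (edgeClass ends i' j') :=
  Finset.disjoint_left.2 fun _ he he' =>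
    h (((mem_edgeClass ends).1 he).symm.trans ((mem_edgeClass ends).1 he'))

theorem mem_kappaInvs {e : Fin (r+1) → Fin (r+1) → ℕ} {pr : Fin (r+1) × Fin (r+1)} :
    pr ∈ kappaInvs e p ↔ isKappaInv e p pr.1 pr.2 := by
  simp [kappaInvs]

theorem isKappaInv.isDesc {e : Fin (r+1) → Fin (r+1) → ℕ} {i j : Fin (r+1)}
    (h : isKappaInv e p i j) : IsDesc p j i := h.2.2.2.1

theorem mem_parentMaps {e : Fin (r+1) → Fin (r+1) → ℕ} :
    p ∈ parentMaps e ↔ IsRootedTree 0 p ∧ ∀ w, w ≠ 0 → 0 < e w (p w) := by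
  simp only [parentMaps, mem_filter, mem_univ, true_and]
  constructor
  · rintro ⟨h0, h1, h2⟩
    exact ⟨⟨h0, h2⟩, fun w hw => (h1 w hw).2⟩
  · rintro ⟨hT, h1⟩
    exact ⟨hT.1, fun w hw => ⟨hT.parent_ne hw, h1 w hw⟩, hT.2⟩

theorem sym2_diag_ne {V : Type*} {a b c : V} (h : b ≠ c) : s(a, a) ≠ s(b, c) := by
  intro h'
  rcases Sym2.eq_iff.1 h' with ⟨h1, h2⟩ | ⟨h1, h2⟩
  · exact h (h1.symm.trans h2)
  · exact h (h2.symm.trans h1)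

theorem card_freeEdges (hp : IsRootedTree 0 p) :
    (freeEdges ends p).card = ∑ i, eCnt ends i i + kappaStat (eCnt ends) p := by
  rw [freeEdges, card_union_of_disjoint, card_biUnion, card_biUnion]
  · simp only [card_edgeClass]
    rfl
  · intro x hx y hy hxy
    rw [mem_coe, mem_kappaInvs] at hx hy
    refine disjoint_edgeClass ends fun h => hxy ?_
    have := hp.sym2_inj hx.1 hy.1 hx.isDesc hy.isDesc h
    exact Prod.ext this.1 this.2
  · intro i _ j _ hij
    refine disjoint_edgeClass ends fun h => hij ?_
    rcases Sym2.eq_iff.1 h with h | h <;> exact h.1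
  · simp only [disjoint_biUnion_left, disjoint_biUnion_right]
    intro x hx i _
    exact disjoint_edgeClass ends (sym2_diag_ne (mem_kappaInvs.1 hx).2.2.2.2.2.1)

theorem disjoint_freeEdges (hp : IsRootedTree 0 p) {w : Fin (r+1)} (hw : w ≠ 0) :
    Disjoint (freeEdges ends p) (edgeClass ends w (p w)) := by
  rw [freeEdges, disjoint_union_left, disjoint_biUnion_left, disjoint_biUnion_left]
  refine ⟨fun i _ => disjoint_edgeClass ends (sym2_diag_ne (hp.parent_ne hw).symm), fun x hx => ?_⟩
  rw [mem_kappaInvs] at hx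
  refine disjoint_edgeClass ends fun h => hx.2.2.1 ?_
  have := hp.sym2_inj hx.1 hw hx.isDesc (IsDesc.refl p w) (h.trans Sym2.eq_swap)
  exact this.1.trans this.2.symm

theorem disjoint_treeEdges (hp : IsRootedTree 0 p) {w w' : Fin (r+1)} (hw : w ≠ 0) (hw' : w' ≠ 0)
    (hne : w ≠ w') : Disjoint (edgeClass ends w (p w)) (edgeClass ends w' (p w')) := by
  rw [edgeClass_comm ends w, edgeClass_comm ends w']
  exact disjoint_edgeClass ends fun h =>
    hne (hp.sym2_inj hw hw' (IsDesc.refl p w) (IsDesc.refl p w') h).1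

theorem isNeighborTree_iff (hp : IsRootedTree 0 p) (S : Finset E) :
    IsNeighborTree (fun a b => ∃ e ∈ S, ends e = s(a, b)) 0 p ↔
      S ⊆ freeEdges ends p ∪ (univ.erase 0).biUnion (fun w => edgeClass ends w (p w)) ∧
        ∀ w ∈ univ.erase 0, (S ∩ edgeClass ends w (p w)).Nonempty := by
  constructor
  · intro h
    refine ⟨fun e he => ?_, fun w hw => ?_⟩
    · have hgood : ∀ a b, ends e = s(a, b) → IsGoodPair p a b →
          e ∈ freeEdges ends p ∪ (univ.erase 0).biUnion (fun w => edgeClass ends w (p w)) := by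
        rintro a b hab ⟨c, rfl, hne, hbc, hle⟩
        have hc : c ≠ 0 := by
          rintro rfl
          exact hne hp.1.symm
        rcases hle.eq_or_lt with rfl | hlt
        · refine mem_union_right _ (mem_biUnion.2 ⟨b, mem_erase.2 ⟨hc, mem_univ b⟩, ?_⟩)
          exact (mem_edgeClass ends).2 (hab.trans Sym2.eq_swap)
        · refine mem_union_left _ (mem_union_right _ (mem_biUnion.2 ⟨(c, b), ?_, ?_⟩))
          · refine mem_kappaInvs.2 ⟨hc, hp.ne_root hc hbc, hlt.ne', hbc, hlt, ?_, ?_⟩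
            · intro (h' : p c = b)
              exact hp.not_isDesc_parent hc (h' ▸ hbc)
            · rw [← card_edgeClass]
              exact card_pos.2 ⟨e, (mem_edgeClass ends).2 (hab.trans Sym2.eq_swap)⟩
          · exact (mem_edgeClass ends).2 hab
      obtain ⟨a, b, hab⟩ : ∃ a b, ends e = s(a, b) :=
        Sym2.ind (f := fun z => ∃ a b, z = s(a, b)) (fun a b => ⟨a, b, rfl⟩) (ends e)
      rcases h.good a b ⟨e, he, hab⟩ with rfl | hab' | hba
      · exact mem_union_left _ (mem_union_left _
          (mem_biUnion.2 ⟨a, mem_univ a, (mem_edgeClass ends).2 hab⟩))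
      · exact hgood a b hab hab'
      · exact hgood b a (hab.trans Sym2.eq_swap) hba
    · obtain ⟨e, he, hew⟩ := h.rel_parent w (ne_of_mem_erase hw)
      exact ⟨e, mem_inter.2 ⟨he, (mem_edgeClass ends).2 hew⟩⟩
  · rintro ⟨hsub, hmeet⟩
    refine ⟨hp, fun w hw => ?_, ?_⟩
    · obtain ⟨e, he⟩ := hmeet w (mem_erase.2 ⟨hw, mem_univ w⟩)
      exact ⟨e, (mem_inter.1 he).1, (mem_edgeClass ends).1 (mem_inter.1 he).2⟩
    · have hlift : ∀ a b c d, s(a, b) = s(c, d) → IsGoodPair p c d →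
          a = b ∨ IsGoodPair p a b ∨ IsGoodPair p b a := by
        intro a b c d h hcd
        rcases Sym2.eq_iff.1 h with ⟨rfl, rfl⟩ | ⟨rfl, rfl⟩
        · exact Or.inr (Or.inl hcd)
        · exact Or.inr (Or.inr hcd)
      rintro a b ⟨e, he, hab⟩
      rcases mem_union.1 (hsub he) with he | he
      · rcases mem_union.1 he with he | he
        · obtain ⟨i, -, hi⟩ := mem_biUnion.1 he
          have h := hab.symm.trans ((mem_edgeClass ends).1 hi)
          left
          rcases Sym2.eq_iff.1 h with ⟨h1, h2⟩ | ⟨h1, h2⟩ <;> exact h1.trans h2.symm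
        · obtain ⟨x, hx, hi⟩ := mem_biUnion.1 he
          rw [mem_kappaInvs] at hx
          exact hlift a b _ _ (hab.symm.trans ((mem_edgeClass ends).1 hi))
            ⟨x.1, rfl, (hp.parent_ne hx.1).symm, hx.isDesc, hx.2.2.2.2.1.le⟩
      · obtain ⟨w, hw, hi⟩ := mem_biUnion.1 he
        exact hlift a b _ _ (hab.symm.trans (((mem_edgeClass ends).1 hi).trans Sym2.eq_swap))
          ⟨w, rfl, (hp.parent_ne (ne_of_mem_erase hw)).symm, IsDesc.refl p w, le_rfl⟩

/-- The contribution of a fixed spanning tree to the generating function of connected edge sets. -/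
theorem sum_isNeighborTree {A : Type*} [CommRing A] (hp : IsRootedTree 0 p) (q : A) :
    (∑ S : Finset E, if IsNeighborTree (fun a b => ∃ e ∈ S, ends e = s(a, b)) 0 p
        then (q - 1) ^ S.card else 0) =
      (q - 1) ^ r * (q ^ (∑ i, eCnt ends i i) * (q ^ kappaStat (eCnt ends) p *
        ∏ w ∈ univ.erase (0 : Fin (r+1)), nq q (eCnt ends w (p w)))) := by
  have hmeet := sum_powerset_meeting (freeEdges ends p) (univ.erase 0)
    (fun w => edgeClass ends w (p w)) (fun w hw => disjoint_freeEdges ends hp (ne_of_mem_erase hw))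
    (fun w hw w' hw' => disjoint_treeEdges ends hp (ne_of_mem_erase hw) (ne_of_mem_erase hw'))
    (q - 1)
  have hprod : ∏ w ∈ univ.erase (0 : Fin (r+1)), (q ^ (edgeClass ends w (p w)).card - 1) =
      (q - 1) ^ r * ∏ w ∈ univ.erase (0 : Fin (r+1)), nq q (eCnt ends w (p w)) := by
    have hr : (q - 1) ^ r = ∏ _w ∈ univ.erase (0 : Fin (r+1)), (q - 1) := by
      rw [prod_const, card_erase_of_mem (mem_univ _), card_univ, Fintype.card_fin,
        Nat.add_sub_cancel]
    rw [hr, ← prod_mul_distrib]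
    exact prod_congr rfl fun w _ => by
      rw [card_edgeClass, nq, mul_geom_sum]
  rw [sub_add_cancel, card_freeEdges ends hp, hprod] at hmeet
  calc _ = _ := ?_
    _ = _ := hmeet
    _ = _ := by ring
  trans ∑ S ∈ (freeEdges ends p ∪ (univ.erase 0).biUnion
      fun w => edgeClass ends w (p w)).powerset.filter (fun S => ∀ w ∈ univ.erase 0,
        (S ∩ edgeClass ends w (p w)).Nonempty), (q - 1) ^ S.card
  swap
  · rw [sum_filter]
    congr!
  rw [← sum_filter]
  refine sum_congr ?_ fun _ _ => rfl
  ext S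
  rw [mem_filter, mem_filter, mem_powerset, isNeighborTree_iff ends hp]
  exact and_iff_right (mem_univ S)

theorem sum_connected {A : Type*} [CommRing A] (q : A) :
    ∑ S ∈ (univ : Finset E).powerset.filter (fun S => SConnected ends S), (q - 1) ^ S.card =
      (q - 1) ^ r * Iinv (eCnt ends) q := by
  have hsymm : ∀ (S : Finset E) (a b : Fin (r+1)), (∃ e ∈ S, ends e = s(a, b)) →
      ∃ e ∈ S, ends e = s(b, a) := fun S a b ⟨e, he, h⟩ => ⟨e, he, h.trans Sym2.eq_swap⟩
  have htree : ∀ S : Finset E, (if SConnected ends S then (q - 1) ^ S.card else 0) =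
      ∑ p ∈ parentMaps (eCnt ends),
        if IsNeighborTree (fun a b => ∃ e ∈ S, ends e = s(a, b)) 0 p
          then (q - 1) ^ S.card else 0 := by
    intro S
    split_ifs with hS
    · obtain ⟨p, hp, huniq⟩ := existsUnique_isNeighborTree (hsymm S) 0 fun u => hS u 0
      have hmem : p ∈ parentMaps (eCnt ends) := by
        refine mem_parentMaps.2 ⟨hp.isRootedTree, fun w hw => ?_⟩
        obtain ⟨e, -, he⟩ := hp.rel_parent w hw
        exact card_pos.2 ⟨e, (mem_edgeClass ends).2 he⟩
      rw [sum_eq_single_of_mem p hmem fun p' _ hne => if_neg fun h => hne (huniq p' h)]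
      exact (if_pos hp).symm
    · exact (sum_eq_zero fun p _ => if_neg fun hp => hS (hp.reflTransGen (hsymm S))).symm
  rw [powerset_univ, sum_filter, sum_congr rfl fun S _ => htree S, sum_comm, Iinv, mul_sum, mul_sum]
  exact sum_congr rfl fun p hp => sum_isNeighborTree ends (mem_parentMaps.1 hp).1 q

end EdgeSets

/-- **`𝓘_G(q) = T_G(1,q)`** (equations (1.8)/(3.2)): for a multigraph `G` on `Fin (r+1)`,
`Σ_{S ⊆ E, (V,S) connected} (q-1)^{#S} = (q-1)^{#V-1} 𝓘_G(q)`. -/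
theorem stmt6 (r : ℕ) {E : Type*} [Fintype E] (ends : E → Sym2 (Fin (r+1))) :
    ∑ S ∈ (univ : Finset E).powerset.filter (fun S => SConnected ends S),
        ((Polynomial.X : Polynomial ℤ) - 1) ^ S.card =
      ((Polynomial.X : Polynomial ℤ) - 1) ^ r *
        Iinv (eCnt ends) (Polynomial.X : Polynomial ℤ) := by
  exact sum_connected ends _

end
end
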